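/- arXiv:1704.01735 — 3 statements merged into one kernel-verified Lean document; each statement's English description precedes it below -/
import Mathlib

section
/- For every matrix g in the subgroup of GL(6, ℂ) generated by S and T and every v ∈ ℂ^6, each of the polynomials Φ4, Φ8, Φ12, Φ12′, Φ16, Φ18, Φ20, Φ30 satisfies Φ(g·v) = Φ(v); i.e., all of these are G-invariant polynomials in six variables. -/
open Complex Finset

noncomputable section

/-- `ζ = exp(2πi/13)`. -/
def zeta13 : ℂ := Complex.exp (2 * Real.pi * Complex.I / 13)

local notation "ζ" => zeta13

/-- The diagonal matrix `T = diag(ζ^7, ζ^11, ζ^8, ζ^6, ζ^2, ζ^5)`. -/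
def Tmat : Matrix (Fin 6) (Fin 6) ℂ :=
  Matrix.diagonal ![ζ ^ 7, ζ ^ 11, ζ ^ 8, ζ ^ 6, ζ ^ 2, ζ ^ 5]

/-- The matrix `S = -(1/√13)·M`. -/
def Smat : Matrix (Fin 6) (Fin 6) ℂ :=
  (-(1 / (Real.sqrt 13 : ℂ))) • Matrix.of
    ![![ζ^12 - ζ, ζ^10 - ζ^3, ζ^4 - ζ^9, ζ^5 - ζ^8, ζ^2 - ζ^11, ζ^6 - ζ^7],
      ![ζ^10 - ζ^3, ζ^4 - ζ^9, ζ^12 - ζ, ζ^2 - ζ^11, ζ^6 - ζ^7, ζ^5 - ζ^8],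
      ![ζ^4 - ζ^9, ζ^12 - ζ, ζ^10 - ζ^3, ζ^6 - ζ^7, ζ^5 - ζ^8, ζ^2 - ζ^11],
      ![ζ^5 - ζ^8, ζ^2 - ζ^11, ζ^6 - ζ^7, ζ - ζ^12, ζ^3 - ζ^10, ζ^9 - ζ^4],
      ![ζ^2 - ζ^11, ζ^6 - ζ^7, ζ^5 - ζ^8, ζ^3 - ζ^10, ζ^9 - ζ^4, ζ - ζ^12],
      ![ζ^6 - ζ^7, ζ^5 - ζ^8, ζ^2 - ζ^11, ζ^9 - ζ^4, ζ - ζ^12, ζ^3 - ζ^10]]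

/-- The matrix `H`, mapping `(z1,…,z6)` to `(z6, z4, z5, −z3, −z1, −z2)`. -/
def Hmat : Matrix (Fin 6) (Fin 6) ℂ :=
  Matrix.of
    ![![0,0,0,0,0,1], ![0,0,0,1,0,0], ![0,0,0,0,1,0],
      ![0,0,-1,0,0,0], ![-1,0,0,0,0,0], ![0,-1,0,0,0,0]]

/-- The senary quadratic forms `A_0, …, A_6` (here `v 0 = z1, …, v 5 = z6`). -/
def A : ℕ → (Fin 6 → ℂ) → ℂ
  | 0, v => v 0 * v 3 + v 1 * v 4 + v 2 * v 5
  | 1, v => v 0 ^ 2 - 2 * v 2 * v 3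
  | 2, v => -v 4 ^ 2 - 2 * v 1 * v 3
  | 3, v => v 1 ^ 2 - 2 * v 0 * v 4
  | 4, v => v 2 ^ 2 - 2 * v 1 * v 5
  | 5, v => -v 3 ^ 2 - 2 * v 0 * v 5
  | 6, v => -v 5 ^ 2 - 2 * v 2 * v 4
  | _, _ => 0

/-- `w_ν = (A0 + ζ^ν A1 + ζ^{4ν} A2 + ζ^{9ν} A3 + ζ^{3ν} A4 + ζ^{12ν} A5 + ζ^{10ν} A6)^2`. -/
def w (ν : ℕ) (v : Fin 6 → ℂ) : ℂ :=
  (A 0 v + ζ ^ ν * A 1 v + ζ ^ (4 * ν) * A 2 v + ζ ^ (9 * ν) * A 3 v +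
    ζ ^ (3 * ν) * A 4 v + ζ ^ (12 * ν) * A 5 v + ζ ^ (10 * ν) * A 6 v) ^ 2

/-- `w_∞ = 13·A0^2`. -/
def winf (v : Fin 6 → ℂ) : ℂ := 13 * A 0 v ^ 2

/-- The senary cubic forms `D_0, …, D_12` (here `v 0 = z1, …, v 5 = z6`). -/
def D : ℕ → (Fin 6 → ℂ) → ℂ
  | 0, v => v 0 * v 1 * v 2
  | 1, v => 2 * v 1 * v 2 ^ 2 + v 1 ^ 2 * v 5 - v 3 ^ 2 * v 4 + v 0 * v 4 * v 5
  | 2, v => -v 5 ^ 3 + v 1 ^ 2 * v 3 - 2 * v 1 * v 4 ^ 2 + v 0 * v 3 * v 4 + 3 * v 2 * v 4 * v 5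
  | 3, v => 2 * v 0 * v 1 ^ 2 + v 0 ^ 2 * v 4 - v 3 * v 5 ^ 2 + v 2 * v 3 * v 4
  | 4, v => -v 1 ^ 2 * v 2 + v 0 * v 5 ^ 2 - 2 * v 3 ^ 2 * v 5 - v 0 * v 2 * v 4
  | 5, v => -v 3 ^ 3 + v 2 ^ 2 * v 4 - 2 * v 2 * v 5 ^ 2 + v 1 * v 4 * v 5 + 3 * v 0 * v 3 * v 5
  | 6, v => -v 4 ^ 3 + v 0 ^ 2 * v 5 - 2 * v 0 * v 3 ^ 2 + v 2 * v 3 * v 5 + 3 * v 1 * v 3 * v 4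
  | 7, v => -v 1 ^ 3 + v 2 * v 3 ^ 2 - v 0 * v 2 * v 5 - 3 * v 0 * v 1 * v 4 + 2 * v 0 ^ 2 * v 3
  | 8, v => -v 0 ^ 3 + v 1 * v 5 ^ 2 - v 1 * v 2 * v 4 - 3 * v 0 * v 2 * v 3 + 2 * v 2 ^ 2 * v 5
  | 9, v => 2 * v 0 ^ 2 * v 2 + v 2 ^ 2 * v 3 - v 4 ^ 2 * v 5 + v 1 * v 3 * v 5
  | 10, v => -v 0 * v 2 ^ 2 + v 1 * v 3 ^ 2 - 2 * v 3 * v 4 ^ 2 - v 0 * v 1 * v 5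
  | 11, v => -v 2 ^ 3 + v 0 * v 4 ^ 2 - v 0 * v 1 * v 3 - 3 * v 1 * v 2 * v 5 + 2 * v 1 ^ 2 * v 4
  | 12, v => -v 0 ^ 2 * v 1 + v 2 * v 4 ^ 2 - 2 * v 4 * v 5 ^ 2 - v 1 * v 2 * v 3
  | _, _ => 0

/-- The senary cubic form `D_∞ = z4 z5 z6`. -/
def Dinf (v : Fin 6 → ℂ) : ℂ := v 3 * v 4 * v 5

/-- The senary sextic forms `G_0, …, G_12`. -/
def Gs : ℕ → (Fin 6 → ℂ) → ℂ
  | 0, v => D 0 v ^ 2 + Dinf v ^ 2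
  | 1, v => -D 7 v ^ 2 + 2 * D 0 v * D 1 v + 10 * Dinf v * D 1 v + 2 * D 2 v * D 12 v
      - 2 * D 3 v * D 11 v - 4 * D 4 v * D 10 v - 2 * D 9 v * D 5 v
  | 2, v => -2 * D 1 v ^ 2 - 4 * D 0 v * D 2 v + 6 * Dinf v * D 2 v - 2 * D 4 v * D 11 v
      + 2 * D 5 v * D 10 v - 2 * D 6 v * D 9 v - 2 * D 7 v * D 8 v
  | 3, v => -D 8 v ^ 2 + 2 * D 0 v * D 3 v + 10 * Dinf v * D 3 v + 2 * D 6 v * D 10 v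
      - 2 * D 9 v * D 7 v - 4 * D 12 v * D 4 v - 2 * D 1 v * D 2 v
  | 4, v => -D 2 v ^ 2 + 10 * D 0 v * D 4 v - 2 * Dinf v * D 4 v + 2 * D 5 v * D 12 v
      - 2 * D 9 v * D 8 v - 4 * D 1 v * D 3 v - 2 * D 10 v * D 7 v
  | 5, v => -2 * D 9 v ^ 2 - 4 * D 0 v * D 5 v + 6 * Dinf v * D 5 v - 2 * D 10 v * D 8 v
      + 2 * D 6 v * D 12 v - 2 * D 2 v * D 3 v - 2 * D 11 v * D 7 v
  | 6, v => -2 * D 3 v ^ 2 - 4 * D 0 v * D 6 v + 6 * Dinf v * D 6 v - 2 * D 12 v * D 7 v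
      + 2 * D 2 v * D 4 v - 2 * D 5 v * D 1 v - 2 * D 8 v * D 11 v
  | 7, v => -2 * D 10 v ^ 2 + 6 * D 0 v * D 7 v + 4 * Dinf v * D 7 v - 2 * D 1 v * D 6 v
      - 2 * D 2 v * D 5 v - 2 * D 8 v * D 12 v - 2 * D 9 v * D 11 v
  | 8, v => -2 * D 4 v ^ 2 + 6 * D 0 v * D 8 v + 4 * Dinf v * D 8 v - 2 * D 3 v * D 5 v
      - 2 * D 6 v * D 2 v - 2 * D 11 v * D 10 v - 2 * D 1 v * D 7 v
  | 9, v => -D 11 v ^ 2 + 2 * D 0 v * D 9 v + 10 * Dinf v * D 9 v + 2 * D 5 v * D 4 v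
      - 2 * D 1 v * D 8 v - 4 * D 10 v * D 12 v - 2 * D 3 v * D 6 v
  | 10, v => -D 5 v ^ 2 + 10 * D 0 v * D 10 v - 2 * Dinf v * D 10 v + 2 * D 6 v * D 4 v
      - 2 * D 3 v * D 7 v - 4 * D 9 v * D 1 v - 2 * D 12 v * D 11 v
  | 11, v => -2 * D 12 v ^ 2 + 6 * D 0 v * D 11 v + 4 * Dinf v * D 11 v - 2 * D 9 v * D 2 v
      - 2 * D 5 v * D 6 v - 2 * D 7 v * D 4 v - 2 * D 3 v * D 8 v
  | 12, v => -D 6 v ^ 2 + 10 * D 0 v * D 12 v - 2 * Dinf v * D 12 v + 2 * D 2 v * D 10 v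
      - 2 * D 1 v * D 11 v - 4 * D 3 v * D 9 v - 2 * D 4 v * D 8 v
  | _, _ => 0

/-- `δ_ν = −13·G0 + Σ_{j=1}^{12} ζ^{jν} G_j`. -/
def deltaF (ν : ℕ) (v : Fin 6 → ℂ) : ℂ :=
  -13 * Gs 0 v + ∑ j ∈ Finset.Icc 1 12, ζ ^ (j * ν) * Gs j v

/-- `δ_∞ = 13^2·G0`. -/
def deltaInf (v : Fin 6 → ℂ) : ℂ := 13 ^ 2 * Gs 0 v

/-- `Φ4 = Σ_ν w_ν + w_∞`. -/
def Phi4 (v : Fin 6 → ℂ) : ℂ := (∑ ν ∈ Finset.range 13, w ν v) + winf v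

/-- `Φ8 = Σ_ν w_ν^2 + w_∞^2`. -/
def Phi8 (v : Fin 6 → ℂ) : ℂ := (∑ ν ∈ Finset.range 13, w ν v ^ 2) + winf v ^ 2

/-- `Φ12′ = −(1/(13·30))(Σ_ν w_ν^3 + w_∞^3)`. -/
def Phi12' (v : Fin 6 → ℂ) : ℂ :=
  -(1 / (13 * 30)) * ((∑ ν ∈ Finset.range 13, w ν v ^ 3) + winf v ^ 3)

/-- `Φ16 = Σ_ν w_ν^4 + w_∞^4`. -/
def Phi16 (v : Fin 6 → ℂ) : ℂ := (∑ ν ∈ Finset.range 13, w ν v ^ 4) + winf v ^ 4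

/-- `Φ20 = (1/(13·25))(Σ_ν w_ν^5 + w_∞^5)`. -/
def Phi20 (v : Fin 6 → ℂ) : ℂ :=
  (1 / (13 * 25)) * ((∑ ν ∈ Finset.range 13, w ν v ^ 5) + winf v ^ 5)

/-- `Φ12 = −(1/(13·52))(Σ_ν δ_ν^2 + δ_∞^2)`. -/
def Phi12 (v : Fin 6 → ℂ) : ℂ :=
  -(1 / (13 * 52)) * ((∑ ν ∈ Finset.range 13, deltaF ν v ^ 2) + deltaInf v ^ 2)

/-- `Φ18 = (1/(13·6))(Σ_ν δ_ν^3 + δ_∞^3)`. -/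
def Phi18 (v : Fin 6 → ℂ) : ℂ :=
  (1 / (13 * 6)) * ((∑ ν ∈ Finset.range 13, deltaF ν v ^ 3) + deltaInf v ^ 3)

/-- `Φ30 = −(1/(13·1315))(Σ_ν δ_ν^5 + δ_∞^5)`. -/
def Phi30 (v : Fin 6 → ℂ) : ℂ :=
  -(1 / (13 * 1315)) * ((∑ ν ∈ Finset.range 13, deltaF ν v ^ 5) + deltaInf v ^ 5)

/-- `q^α = exp(2πiαz)`. -/
def qp (α : ℚ) (z : ℂ) : ℂ := Complex.exp (2 * Real.pi * Complex.I * (α : ℂ) * z)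

/-- `Σ_{n∈ℤ} (−1)^n q^{(13n^2+cn)/2}`. -/
def thetaSum (c : ℤ) (z : ℂ) : ℂ :=
  ∑' n : ℤ, (-1 : ℂ) ^ n * qp ((13 * (n : ℚ) ^ 2 + (c : ℚ) * (n : ℚ)) / 2) z

/-- The theta constants of order 13: `a_1, …, a_6`. -/
def thc : ℕ → ℂ → ℂ
  | 1, z => qp (121 / 104) z * thetaSum 11 z
  | 2, z => qp (49 / 104) z * thetaSum 7 z
  | 3, z => qp (25 / 104) z * thetaSum 5 z
  | 4, z => -(qp (9 / 104) z * thetaSum 3 z)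
  | 5, z => qp (81 / 104) z * thetaSum 9 z
  | 6, z => qp (1 / 104) z * thetaSum 1 z
  | _, _ => 0

/-- The vector `A(z) = (a1(z), …, a6(z))`. -/
def Avec (z : ℂ) : Fin 6 → ℂ := fun i => thc (i.val + 1) z

/-- The Dedekind eta function `η(z) = q^{1/24} Π_{n=1}^∞ (1−q^n)`. -/
def etaF (z : ℂ) : ℂ :=
  qp (1 / 24) z * ∏' n : ℕ, (1 - Complex.exp (2 * Real.pi * Complex.I * z) ^ (n + 1))

/-- The vector `(x1(z), …, x6(z))` with `x_i(z) = η(z)·a_i(z)`. -/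
def X (z : ℂ) : Fin 6 → ℂ := fun i => etaF z * thc (i.val + 1) z

/-- The discriminant `Δ(z) = η(z)^24`. -/
def Delta (z : ℂ) : ℂ := etaF z ^ 24

/-- The Eisenstein series `E4(z) = (1/2) Σ_{gcd(m,n)=1} (mz+n)^{−4}`. -/
def E4 (z : ℂ) : ℂ :=
  (1 / 2) * ∑' p : {p : ℤ × ℤ // Int.gcd p.1 p.2 = 1},
    ((p.1.1 : ℂ) * z + (p.1.2 : ℂ)) ^ (-4 : ℤ)

/-- The Eisenstein series `E6(z) = (1/2) Σ_{gcd(m,n)=1} (mz+n)^{−6}`. -/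
def E6 (z : ℂ) : ℂ :=
  (1 / 2) * ∑' p : {p : ℤ × ℤ // Int.gcd p.1 p.2 = 1},
    ((p.1.1 : ℂ) * z + (p.1.2 : ℂ)) ^ (-6 : ℤ)

lemma zeta13_isPrimitiveRoot : IsPrimitiveRoot ζ 13 := by
  simpa [zeta13] using Complex.isPrimitiveRoot_exp 13 (by norm_num)

lemma zeta13_pow : ζ ^ 13 = 1 := zeta13_isPrimitiveRoot.pow_eq_one

lemma zeta13_geom_sum : ∑ i ∈ Finset.range 13, ζ ^ i = 0 :=
  zeta13_isPrimitiveRoot.geom_sum_eq_zero (by norm_num)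

lemma zeta13_mul_pow (n : ℕ) : ζ ^ (n % 13) = ζ ^ n := by
  conv_rhs => rw [← Nat.mod_add_div n 13, pow_add, pow_mul, zeta13_pow, one_pow, mul_one]

/-- Reduction of the powers of `ζ` to the basis `1, ζ, …, ζ ^ 11`. -/
lemma zeta13_reduce :
    ζ ^ 12 = -(1 + ζ + ζ ^ 2 + ζ ^ 3 + ζ ^ 4 + ζ ^ 5 + ζ ^ 6 + ζ ^ 7 + ζ ^ 8 + ζ ^ 9 + ζ ^ 10 +
      ζ ^ 11) ∧
    ζ ^ 13 = 1 ∧ ζ ^ 14 = ζ ∧ ζ ^ 15 = ζ ^ 2 ∧ ζ ^ 16 = ζ ^ 3 ∧ ζ ^ 17 = ζ ^ 4 ∧ ζ ^ 18 = ζ ^ 5 ∧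
    ζ ^ 19 = ζ ^ 6 ∧ ζ ^ 20 = ζ ^ 7 ∧ ζ ^ 21 = ζ ^ 8 ∧ ζ ^ 22 = ζ ^ 9 ∧ ζ ^ 23 = ζ ^ 10 ∧
    ζ ^ 24 = ζ ^ 11 ∧ ζ ^ 25 = ζ ^ 12 ∧ ζ ^ 26 = 1 ∧ ζ ^ 27 = ζ ∧ ζ ^ 28 = ζ ^ 2 ∧
    ζ ^ 29 = ζ ^ 3 ∧ ζ ^ 30 = ζ ^ 4 ∧ ζ ^ 31 = ζ ^ 5 ∧ ζ ^ 32 = ζ ^ 6 ∧ ζ ^ 33 = ζ ^ 7 ∧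
    ζ ^ 34 = ζ ^ 8 ∧ ζ ^ 35 = ζ ^ 9 ∧ ζ ^ 36 = ζ ^ 10 ∧ ζ ^ 37 = ζ ^ 11 ∧ ζ ^ 38 = ζ ^ 12 ∧
    ζ ^ 39 = 1 ∧ ζ ^ 40 = ζ ∧ ζ ^ 41 = ζ ^ 2 ∧ ζ ^ 42 = ζ ^ 3 ∧ ζ ^ 43 = ζ ^ 4 ∧ ζ ^ 44 = ζ ^ 5 ∧
    ζ ^ 45 = ζ ^ 6 ∧ ζ ^ 46 = ζ ^ 7 ∧ ζ ^ 47 = ζ ^ 8 ∧ ζ ^ 48 = ζ ^ 9 ∧ ζ ^ 49 = ζ ^ 10 ∧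
    ζ ^ 50 = ζ ^ 11 := by
  have h := zeta13_geom_sum
  simp only [Finset.sum_range_succ, Finset.range_zero, Finset.sum_empty] at h
  refine ⟨by linear_combination h, ?_⟩
  simp [← zeta13_mul_pow]

/-- The quadratic Gauss sum modulo 13. -/
def gauss13 : ℂ := 1 + 2 * (ζ + ζ ^ 3 + ζ ^ 4 + ζ ^ 9 + ζ ^ 10 + ζ ^ 12)

lemma gauss13_sq : gauss13 ^ 2 = 13 := by
  unfold gauss13
  ring_nf
  simp only [zeta13_reduce]
  ring

/-- The matrix `M`, so that `S = -(1/√13)·M`. -/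
def Mmat : Matrix (Fin 6) (Fin 6) ℂ :=
  Matrix.of
    ![![ζ^12 - ζ, ζ^10 - ζ^3, ζ^4 - ζ^9, ζ^5 - ζ^8, ζ^2 - ζ^11, ζ^6 - ζ^7],
      ![ζ^10 - ζ^3, ζ^4 - ζ^9, ζ^12 - ζ, ζ^2 - ζ^11, ζ^6 - ζ^7, ζ^5 - ζ^8],
      ![ζ^4 - ζ^9, ζ^12 - ζ, ζ^10 - ζ^3, ζ^6 - ζ^7, ζ^5 - ζ^8, ζ^2 - ζ^11],
      ![ζ^5 - ζ^8, ζ^2 - ζ^11, ζ^6 - ζ^7, ζ - ζ^12, ζ^3 - ζ^10, ζ^9 - ζ^4],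
      ![ζ^2 - ζ^11, ζ^6 - ζ^7, ζ^5 - ζ^8, ζ^3 - ζ^10, ζ^9 - ζ^4, ζ - ζ^12],
      ![ζ^6 - ζ^7, ζ^5 - ζ^8, ζ^2 - ζ^11, ζ^9 - ζ^4, ζ - ζ^12, ζ^3 - ζ^10]]

lemma Mmat_mul_Mmat : Mmat * Mmat = (-13 : ℂ) • 1 := by
  ext i j
  fin_cases i <;> fin_cases j <;>
  simp [Mmat, Matrix.mul_apply, Fin.sum_univ_succ, -mul_eq_zero] <;> ring_nf <;>
    simp only [zeta13_reduce] <;> ring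

lemma Tmat_pow (n : ℕ) : Tmat ^ n = Matrix.diagonal
    ![ζ ^ (7 * n % 13), ζ ^ (11 * n % 13), ζ ^ (8 * n % 13), ζ ^ (6 * n % 13),
      ζ ^ (2 * n % 13), ζ ^ (5 * n % 13)] := by
  simp only [zeta13_mul_pow, Tmat, Matrix.diagonal_pow, pow_mul]
  congr 1
  ext i
  fin_cases i <;> rfl

lemma Mmat_mul_Tmat_mul_Mmat :
    Mmat * Tmat * Mmat = -gauss13 • (Tmat ^ 12 * Mmat * Tmat ^ 12) := by
  rw [Tmat_pow]
  ext i j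
  simp only [Tmat, Matrix.smul_apply, Matrix.mul_diagonal, Matrix.diagonal_mul]
  rw [Matrix.mul_apply]
  simp only [Matrix.mul_diagonal]
  fin_cases i <;> fin_cases j <;>
  simp [Mmat, gauss13, Fin.sum_univ_succ, -mul_eq_zero] <;> ring_nf <;>
    simp only [zeta13_reduce] <;> ring

lemma Mmat_mul_Tmat_sq_mul_Mmat :
    Mmat * Tmat ^ 2 * Mmat = gauss13 • (Tmat ^ 6 * (Hmat * Mmat) * Tmat ^ 6) := by
  simp only [Tmat_pow]
  ext i j
  simp only [Matrix.smul_apply, Matrix.mul_diagonal, Matrix.diagonal_mul]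
  rw [Matrix.mul_apply, Matrix.mul_apply]
  simp only [Matrix.mul_diagonal]
  fin_cases i <;> fin_cases j <;>
  simp [Mmat, Hmat, gauss13, Fin.sum_univ_succ, -mul_eq_zero] <;> ring_nf <;>
    simp only [zeta13_reduce] <;> ring

lemma Hmat_mul_Mmat_mul_Hmat : Hmat * Mmat * Hmat = Mmat := by
  ext i j
  fin_cases i <;> fin_cases j <;>
  simp [Mmat, Hmat, Matrix.mul_apply, Fin.sum_univ_succ]

lemma Tmat_mul_Hmat : Tmat * Hmat = Hmat * Tmat ^ 4 := by
  rw [Tmat_pow, Tmat]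
  ext i j
  simp only [Matrix.mul_diagonal, Matrix.diagonal_mul]
  fin_cases i <;> fin_cases j <;> simp [Hmat]

lemma sqrt13_sq : (Real.sqrt 13 : ℂ) ^ 2 = 13 := by
  rw [← Complex.ofReal_pow, Real.sq_sqrt (by norm_num)]
  norm_num

lemma neg_one_div_sqrt13_sq : (-(1 / (Real.sqrt 13 : ℂ))) ^ 2 = 1 / 13 := by
  rw [neg_sq, div_pow, sqrt13_sq, one_pow]

lemma Smat_eq : Smat = (-(1 / (Real.sqrt 13 : ℂ))) • Mmat := rfl

lemma Smat_mul_Smat : Smat * Smat = (-1 : ℂ) • 1 := by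
  rw [Smat_eq, Matrix.smul_mul, Matrix.mul_smul, Mmat_mul_Mmat, smul_smul, smul_smul, ← sq,
    neg_one_div_sqrt13_sq]
  norm_num

lemma exists_Smat_mul_Tmat_mul_Smat :
    ∃ e : ℂ, e ^ 2 = 1 ∧ Smat * Tmat * Smat = e • (Tmat ^ 12 * Smat * Tmat ^ 12) := by
  refine ⟨-(-(1 / (Real.sqrt 13 : ℂ))) * gauss13, ?_, ?_⟩
  · rw [mul_pow, neg_sq, neg_one_div_sqrt13_sq, gauss13_sq]
    norm_num
  · simp only [Smat_eq, Matrix.smul_mul, Matrix.mul_smul, Mmat_mul_Tmat_mul_Mmat, smul_smul]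
    congr 1
    ring

lemma exists_Smat_mul_Tmat_sq_mul_Smat :
    ∃ e : ℂ, e ^ 2 = 1 ∧ Smat * Tmat ^ 2 * Smat = e • (Tmat ^ 6 * (Hmat * Smat) * Tmat ^ 6) := by
  refine ⟨-(1 / (Real.sqrt 13 : ℂ)) * gauss13, ?_, ?_⟩
  · rw [mul_pow, neg_one_div_sqrt13_sq, gauss13_sq]
    norm_num
  · simp only [Smat_eq, Matrix.smul_mul, Matrix.mul_smul, Mmat_mul_Tmat_sq_mul_Mmat, smul_smul]
    congr 1
    ring

lemma Hmat_mul_Smat_mul_Hmat : Hmat * Smat * Hmat = Smat := by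
  rw [Smat_eq, Matrix.mul_smul, Matrix.smul_mul, Hmat_mul_Mmat_mul_Hmat]

lemma Tmat_pow_mul_Hmat (n : ℕ) : Tmat ^ n * Hmat = Hmat * Tmat ^ (4 * n) := by
  induction n with
  | zero => simp
  | succ n ih => rw [pow_succ, mul_assoc, Tmat_mul_Hmat, ← mul_assoc, ih, mul_assoc, ← pow_add]; rfl

lemma Hmat_mul_transpose : Hmat * Hmat.transpose = 1 := by
  ext i j
  fin_cases i <;> fin_cases j <;> simp [Hmat, Matrix.mul_apply, Fin.sum_univ_succ]

lemma Tmat_pow_mod (n : ℕ) : Tmat ^ (n % 13) = Tmat ^ n := by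
  simp [Tmat_pow, Nat.mul_mod]

/-- Even functions on `ℂ^6` that are invariant under `T` and `H`. -/
structure BorelInvariant (f : (Fin 6 → ℂ) → ℂ) : Prop where
  smul : ∀ (e : ℂ) (v : Fin 6 → ℂ), e ^ 2 = 1 → f (e • v) = f v
  mulVec_T : ∀ v, f (Tmat.mulVec v) = f v
  mulVec_H : ∀ v, f (Hmat.mulVec v) = f v

/-- The translate of `f` by `S T^n`. -/
def slash (f : (Fin 6 → ℂ) → ℂ) (n : ℕ) (v : Fin 6 → ℂ) : ℂ :=
  f ((Smat * Tmat ^ n).mulVec v)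

lemma slash_mod (f : (Fin 6 → ℂ) → ℂ) (n : ℕ) (v : Fin 6 → ℂ) :
    slash f (n % 13) v = slash f n v := by
  rw [slash, Tmat_pow_mod, slash]

lemma slash_mulVec_T (f : (Fin 6 → ℂ) → ℂ) (n : ℕ) (v : Fin 6 → ℂ) :
    slash f n (Tmat.mulVec v) = slash f (n + 1) v := by
  rw [slash, slash, Matrix.mulVec_mulVec, mul_assoc, ← pow_succ]

namespace BorelInvariant

variable {f : (Fin 6 → ℂ) → ℂ}

lemma mulVec_T_pow (hf : BorelInvariant f) (n : ℕ) (v : Fin 6 → ℂ) :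
    f ((Tmat ^ n).mulVec v) = f v := by
  induction n with
  | zero => simp
  | succ n ih => rw [pow_succ', ← Matrix.mulVec_mulVec, hf.mulVec_T, ih]

lemma slash_one (hf : BorelInvariant f) (v : Fin 6 → ℂ) :
    slash f 1 (Smat.mulVec v) = slash f 12 v := by
  obtain ⟨e, he, h⟩ := exists_Smat_mul_Tmat_mul_Smat
  rw [slash, slash, pow_one, Matrix.mulVec_mulVec, h, Matrix.smul_mulVec, hf.smul _ _ he,
    mul_assoc, ← Matrix.mulVec_mulVec, hf.mulVec_T_pow]

lemma slash_two (hf : BorelInvariant f) (v : Fin 6 → ℂ) :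
    slash f 2 (Smat.mulVec v) = slash f 6 v := by
  obtain ⟨e, he, h⟩ := exists_Smat_mul_Tmat_sq_mul_Smat
  rw [slash, slash, Matrix.mulVec_mulVec, h, Matrix.smul_mulVec, hf.smul _ _ he,
    mul_assoc, ← Matrix.mulVec_mulVec, hf.mulVec_T_pow, mul_assoc, ← Matrix.mulVec_mulVec,
    hf.mulVec_H]

lemma slash_mulVec_H (hf : BorelInvariant f) (n : ℕ) (v : Fin 6 → ℂ) :
    slash f n (Hmat.mulVec v) = slash f (4 * n) v := by
  rw [slash, slash, Matrix.mulVec_mulVec, mul_assoc, Tmat_pow_mul_Hmat, ← hf.mulVec_H,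
    Matrix.mulVec_mulVec, ← mul_assoc, ← mul_assoc, Hmat_mul_Smat_mul_Hmat]

lemma slash_conj (hf : BorelInvariant f) {n b : ℕ}
    (h : ∀ v, slash f n (Smat.mulVec v) = slash f b v) (m c : ℕ)
    (hm : 4 * n % 13 = m % 13 := by norm_num) (hc : 4 * c % 13 = b % 13 := by norm_num)
    (v : Fin 6 → ℂ) : slash f m (Smat.mulVec v) = slash f c v := by
  obtain ⟨u, rfl⟩ : ∃ u, Hmat.mulVec u = v :=
    ⟨Hmat.transpose.mulVec v, by rw [Matrix.mulVec_mulVec, Hmat_mul_transpose, Matrix.one_mulVec]⟩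
  rw [hf.slash_mulVec_H, ← slash_mod f (4 * c), hc, slash_mod, ← h,
    ← slash_mod f m, ← hm, slash_mod, ← hf.slash_mulVec_H, Matrix.mulVec_mulVec,
    Matrix.mulVec_mulVec, Hmat_mul_Smat_mul_Hmat]

lemma slash_zero (hf : BorelInvariant f) (v : Fin 6 → ℂ) :
    slash f 0 (Smat.mulVec v) = f v := by
  rw [slash, pow_zero, mul_one, Matrix.mulVec_mulVec, Smat_mul_Smat, Matrix.smul_mulVec,
    hf.smul _ _ (by norm_num), Matrix.one_mulVec]

lemma sum_slash_pow_mulVec_S (hf : BorelInvariant f) (k : ℕ) (v : Fin 6 → ℂ) :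
    (∑ n ∈ Finset.range 13, slash f n (Smat.mulVec v) ^ k) + f (Smat.mulVec v) ^ k =
      (∑ n ∈ Finset.range 13, slash f n v ^ k) + f v ^ k := by
  have h1 := hf.slash_one
  have h4 := hf.slash_conj h1 4 3
  have h3 := hf.slash_conj h4 3 4
  have h12 := hf.slash_conj h3 12 1
  have h9 := hf.slash_conj h12 9 10
  have h10 := hf.slash_conj h9 10 9
  have h2 := hf.slash_two
  have h8 := hf.slash_conj h2 8 8
  have h6 := hf.slash_conj h8 6 2
  have h11 := hf.slash_conj h6 11 7
  have h5 := hf.slash_conj h11 5 5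
  have h7 := hf.slash_conj h5 7 11
  have h0 : f (Smat.mulVec v) = slash f 0 v := by simp [slash]
  simp only [Finset.sum_range_succ, Finset.range_zero, Finset.sum_empty, h0, hf.slash_zero,
    h1, h2, h3, h4, h5, h6, h7, h8, h9, h10, h11, h12]
  ring

lemma sum_slash_pow_mulVec_T (hf : BorelInvariant f) (k : ℕ) (v : Fin 6 → ℂ) :
    (∑ n ∈ Finset.range 13, slash f n (Tmat.mulVec v) ^ k) + f (Tmat.mulVec v) ^ k =
      (∑ n ∈ Finset.range 13, slash f n v ^ k) + f v ^ k := by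
  simp only [slash_mulVec_T, hf.mulVec_T]
  rw [Finset.sum_range_succ, Finset.sum_range_succ' (fun n ↦ slash f n v ^ k),
    ← slash_mod f (12 + 1)]

end BorelInvariant

lemma Tmat_mulVec (v : Fin 6 → ℂ) : Tmat.mulVec v =
    ![ζ ^ 7 * v 0, ζ ^ 11 * v 1, ζ ^ 8 * v 2, ζ ^ 6 * v 3, ζ ^ 2 * v 4, ζ ^ 5 * v 5] := by
  ext i
  rw [Tmat, Matrix.mulVec_diagonal]
  fin_cases i <;> rfl

lemma Hmat_mulVec (v : Fin 6 → ℂ) : Hmat.mulVec v = ![v 5, v 3, v 4, -v 2, -v 0, -v 1] := by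
  ext i
  fin_cases i <;> simp [Hmat, Matrix.mulVec, dotProduct, Fin.sum_univ_succ]

lemma A_mulVec_T (v : Fin 6 → ℂ) :
    A 0 (Tmat.mulVec v) = A 0 v ∧ A 1 (Tmat.mulVec v) = ζ * A 1 v ∧
    A 2 (Tmat.mulVec v) = ζ ^ 4 * A 2 v ∧ A 3 (Tmat.mulVec v) = ζ ^ 9 * A 3 v ∧
    A 4 (Tmat.mulVec v) = ζ ^ 3 * A 4 v ∧ A 5 (Tmat.mulVec v) = ζ ^ 12 * A 5 v ∧
    A 6 (Tmat.mulVec v) = ζ ^ 10 * A 6 v := by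
  rw [Tmat_mulVec]
  refine ⟨?_, ?_, ?_, ?_, ?_, ?_, ?_⟩ <;>
    simp only [A, Matrix.cons_val] <;> ring_nf <;> simp only [zeta13_reduce] <;> ring

lemma D_mulVec_T (v : Fin 6 → ℂ) :
    Dinf (Tmat.mulVec v) = Dinf v ∧ D 0 (Tmat.mulVec v) = D 0 v ∧
    D 1 (Tmat.mulVec v) = ζ * D 1 v ∧ D 2 (Tmat.mulVec v) = ζ ^ 2 * D 2 v ∧
    D 3 (Tmat.mulVec v) = ζ ^ 3 * D 3 v ∧ D 4 (Tmat.mulVec v) = ζ ^ 4 * D 4 v ∧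
    D 5 (Tmat.mulVec v) = ζ ^ 5 * D 5 v ∧ D 6 (Tmat.mulVec v) = ζ ^ 6 * D 6 v ∧
    D 7 (Tmat.mulVec v) = ζ ^ 7 * D 7 v ∧ D 8 (Tmat.mulVec v) = ζ ^ 8 * D 8 v ∧
    D 9 (Tmat.mulVec v) = ζ ^ 9 * D 9 v ∧ D 10 (Tmat.mulVec v) = ζ ^ 10 * D 10 v ∧
    D 11 (Tmat.mulVec v) = ζ ^ 11 * D 11 v ∧ D 12 (Tmat.mulVec v) = ζ ^ 12 * D 12 v := by
  rw [Tmat_mulVec]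
  refine ⟨?_, ?_, ?_, ?_, ?_, ?_, ?_, ?_, ?_, ?_, ?_, ?_, ?_, ?_⟩ <;>
    simp only [D, Dinf, Matrix.cons_val] <;> ring_nf <;> simp only [zeta13_reduce] <;> ring

lemma Gs_mulVec_T (v : Fin 6 → ℂ) {j : ℕ} (hj : j ≤ 12) :
    Gs j (Tmat.mulVec v) = ζ ^ j * Gs j v := by
  interval_cases j <;>
    simp only [Gs, D_mulVec_T] <;> ring_nf <;> simp only [zeta13_reduce] <;> ring

lemma w_mulVec_T (n : ℕ) (v : Fin 6 → ℂ) : w n (Tmat.mulVec v) = w (n + 1) v := by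
  simp only [w, A_mulVec_T]
  ring

lemma deltaF_mulVec_T (n : ℕ) (v : Fin 6 → ℂ) :
    deltaF n (Tmat.mulVec v) = deltaF (n + 1) v := by
  rw [deltaF, deltaF, Gs_mulVec_T v (by norm_num), pow_zero, one_mul]
  congr 1
  refine Finset.sum_congr rfl fun j hj ↦ ?_
  rw [Gs_mulVec_T v (Finset.mem_Icc.1 hj).2]
  ring

lemma borelInvariant_winf : BorelInvariant winf where
  smul e v he := by
    simp only [winf, A, Pi.smul_apply, smul_eq_mul]
    linear_combination (13 * (v 0 * v 3 + v 1 * v 4 + v 2 * v 5) ^ 2) * (e ^ 2 + 1) * he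
  mulVec_T v := by simp only [winf, A_mulVec_T]
  mulVec_H v := by
    simp only [winf, A, Hmat_mulVec, Matrix.cons_val]
    ring

lemma borelInvariant_deltaInf : BorelInvariant deltaInf where
  smul e v he := by
    simp only [deltaInf, Gs, D, Dinf, Pi.smul_apply, smul_eq_mul]
    linear_combination (13 ^ 2 * ((v 0 * v 1 * v 2) ^ 2 + (v 3 * v 4 * v 5) ^ 2)) *
      (e ^ 4 + e ^ 2 + 1) * he
  mulVec_T v := by simp only [deltaInf, Gs, D_mulVec_T]
  mulVec_H v := by
    simp only [deltaInf, Gs, D, Dinf, Hmat_mulVec, Matrix.cons_val]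
    ring

lemma Mmat_mulVec (v : Fin 6 → ℂ) : Mmat.mulVec v =
    ![(ζ^12 - ζ) * v 0 + (ζ^10 - ζ^3) * v 1 + (ζ^4 - ζ^9) * v 2 +
        (ζ^5 - ζ^8) * v 3 + (ζ^2 - ζ^11) * v 4 + (ζ^6 - ζ^7) * v 5,
      (ζ^10 - ζ^3) * v 0 + (ζ^4 - ζ^9) * v 1 + (ζ^12 - ζ) * v 2 +
        (ζ^2 - ζ^11) * v 3 + (ζ^6 - ζ^7) * v 4 + (ζ^5 - ζ^8) * v 5,
      (ζ^4 - ζ^9) * v 0 + (ζ^12 - ζ) * v 1 + (ζ^10 - ζ^3) * v 2 +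
        (ζ^6 - ζ^7) * v 3 + (ζ^5 - ζ^8) * v 4 + (ζ^2 - ζ^11) * v 5,
      (ζ^5 - ζ^8) * v 0 + (ζ^2 - ζ^11) * v 1 + (ζ^6 - ζ^7) * v 2 +
        (ζ - ζ^12) * v 3 + (ζ^3 - ζ^10) * v 4 + (ζ^9 - ζ^4) * v 5,
      (ζ^2 - ζ^11) * v 0 + (ζ^6 - ζ^7) * v 1 + (ζ^5 - ζ^8) * v 2 +
        (ζ^3 - ζ^10) * v 3 + (ζ^9 - ζ^4) * v 4 + (ζ - ζ^12) * v 5,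
      (ζ^6 - ζ^7) * v 0 + (ζ^5 - ζ^8) * v 1 + (ζ^2 - ζ^11) * v 2 +
        (ζ^9 - ζ^4) * v 3 + (ζ - ζ^12) * v 4 + (ζ^3 - ζ^10) * v 5] := by
  ext i
  fin_cases i <;> simp [Mmat, Matrix.mulVec, dotProduct, Fin.sum_univ_succ] <;> ring

set_option maxRecDepth 20000 in
lemma A_zero_mulVec_M (v : Fin 6 → ℂ) : A 0 (Mmat.mulVec v) =
    gauss13 * (A 0 v + A 1 v + A 2 v + A 3 v + A 4 v + A 5 v + A 6 v) := by
  simp only [A, Mmat_mulVec, Matrix.cons_val, gauss13]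
  ring_nf
  simp only [zeta13_reduce]
  ring

/-- The alternating sum of `ζ ^ k` over `1, 3, 9` and their negatives. -/
def gaussR : ℂ := ζ + ζ ^ 3 + ζ ^ 9 - (ζ ^ 4 + ζ ^ 12 + ζ ^ 10)

/-- The alternating sum of `ζ ^ k` over `2, 5, 6` and their negatives. -/
def gaussN : ℂ := ζ ^ 2 + ζ ^ 5 + ζ ^ 6 - (ζ ^ 8 + ζ ^ 7 + ζ ^ 11)

lemma gaussR_sq_add_gaussN_sq : gaussR ^ 2 + gaussN ^ 2 = -13 := by
  unfold gaussR gaussN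
  ring_nf
  simp only [zeta13_reduce]
  ring

/-- The coefficient of `gaussR` in `D_0 (M v)`. -/
def cubicX (v : Fin 6 → ℂ) : ℂ :=
  2 * D 0 v + D 1 v + D 2 v + D 3 v - D 4 v + D 5 v + D 6 v + D 9 v - D 10 v - D 12 v - 3 * Dinf v

/-- The coefficient of `gaussN` in `D_0 (M v)`. -/
def cubicY (v : Fin 6 → ℂ) : ℂ :=
  -3 * D 0 v + D 1 v + D 3 v + D 4 v + D 7 v + D 8 v + D 9 v + D 10 v + D 11 v + D 12 v - 2 * Dinf v

lemma cubicX_sq_add_cubicY_sq (v : Fin 6 → ℂ) : cubicX v ^ 2 + cubicY v ^ 2 = -deltaF 0 v := by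
  simp only [cubicX, cubicY, deltaF, Gs]
  norm_num [Finset.sum_Icc_succ_top, Gs]
  ring

set_option maxRecDepth 100000 in
set_option maxHeartbeats 4000000 in
lemma D_zero_mulVec_M (v : Fin 6 → ℂ) :
    D 0 (Mmat.mulVec v) = gaussR * cubicX v + gaussN * cubicY v := by
  simp only [D, Dinf, Mmat_mulVec, Matrix.cons_val, gaussR, gaussN, cubicX, cubicY]
  ring_nf
  simp only [zeta13_reduce]
  ring

set_option maxRecDepth 100000 in
set_option maxHeartbeats 4000000 in
lemma Dinf_mulVec_M (v : Fin 6 → ℂ) :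
    Dinf (Mmat.mulVec v) = gaussR * cubicY v - gaussN * cubicX v := by
  simp only [D, Dinf, Mmat_mulVec, Matrix.cons_val, gaussR, gaussN, cubicX, cubicY]
  ring_nf
  simp only [zeta13_reduce]
  ring

lemma winf_mulVec_S (v : Fin 6 → ℂ) : winf (Smat.mulVec v) = w 0 v := by
  have h (c : ℂ) (u : Fin 6 → ℂ) : winf (c • u) = (c ^ 2) ^ 2 * winf u := by
    simp only [winf, A, Pi.smul_apply, smul_eq_mul]
    ring
  rw [Smat_eq, Matrix.smul_mulVec, h, neg_one_div_sqrt13_sq, winf, A_zero_mulVec_M, mul_pow,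
    gauss13_sq, w]
  ring

lemma deltaInf_mulVec_S (v : Fin 6 → ℂ) : deltaInf (Smat.mulVec v) = deltaF 0 v := by
  have h (c : ℂ) (u : Fin 6 → ℂ) : deltaInf (c • u) = (c ^ 2) ^ 3 * deltaInf u := by
    simp only [deltaInf, Gs, D, Dinf, Pi.smul_apply, smul_eq_mul]
    ring
  rw [Smat_eq, Matrix.smul_mulVec, h, neg_one_div_sqrt13_sq, deltaInf, Gs, D_zero_mulVec_M,
    Dinf_mulVec_M]
  linear_combination (1 / 13) * (cubicX v ^ 2 + cubicY v ^ 2) * gaussR_sq_add_gaussN_sq -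
    cubicX_sq_add_cubicY_sq v

lemma slash_winf (n : ℕ) (v : Fin 6 → ℂ) : slash winf n v = w n v := by
  induction n generalizing v with
  | zero => rw [slash, pow_zero, mul_one, winf_mulVec_S]
  | succ n ih => rw [← slash_mulVec_T, ih, w_mulVec_T]

lemma slash_deltaInf (n : ℕ) (v : Fin 6 → ℂ) : slash deltaInf n v = deltaF n v := by
  induction n generalizing v with
  | zero => rw [slash, pow_zero, mul_one, deltaInf_mulVec_S]
  | succ n ih => rw [← slash_mulVec_T, ih, deltaF_mulVec_T]

/-- Power sums over the orbit of a `BorelInvariant` function are invariant under the group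
generated by `S` and `T`. -/
lemma BorelInvariant.sum_slash_pow_mulVec {f : (Fin 6 → ℂ) → ℂ} (hf : BorelInvariant f)
    {US UT : Matrix.GeneralLinearGroup (Fin 6) ℂ}
    (hS : (US : Matrix (Fin 6) (Fin 6) ℂ) = Smat) (hT : (UT : Matrix (Fin 6) (Fin 6) ℂ) = Tmat)
    {g : Matrix.GeneralLinearGroup (Fin 6) ℂ} (hg : g ∈ Subgroup.closure {US, UT}) (k : ℕ)
    (v : Fin 6 → ℂ) :
    (∑ n ∈ Finset.range 13, slash f n ((g : Matrix (Fin 6) (Fin 6) ℂ).mulVec v) ^ k) +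
        f ((g : Matrix (Fin 6) (Fin 6) ℂ).mulVec v) ^ k =
      (∑ n ∈ Finset.range 13, slash f n v ^ k) + f v ^ k := by
  induction hg using Subgroup.closure_induction generalizing v with
  | mem x hx =>
    obtain rfl | rfl := hx
    · rw [hS, hf.sum_slash_pow_mulVec_S]
    · rw [hT, hf.sum_slash_pow_mulVec_T]
  | one => simp
  | mul x y _ _ ihx ihy =>
    rw [Units.val_mul, ← Matrix.mulVec_mulVec, ihx, ihy]
  | inv x _ ih =>
    rw [← ih, Matrix.mulVec_mulVec, ← Units.val_mul, mul_inv_cancel, Units.val_one,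
      Matrix.one_mulVec]

/-- all of `Φ4, Φ8, Φ12, Φ12′, Φ16, Φ18, Φ20, Φ30` are invariant under the
subgroup of `GL(6,ℂ)` generated by `S` and `T`. -/
theorem stmt_2 (US UT : Matrix.GeneralLinearGroup (Fin 6) ℂ)
    (hS : (US : Matrix (Fin 6) (Fin 6) ℂ) = Smat)
    (hT : (UT : Matrix (Fin 6) (Fin 6) ℂ) = Tmat)
    (g : Matrix.GeneralLinearGroup (Fin 6) ℂ) (hg : g ∈ Subgroup.closure {US, UT})
    (v : Fin 6 → ℂ) :
    Phi4 ((g : Matrix (Fin 6) (Fin 6) ℂ).mulVec v) = Phi4 v ∧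
    Phi8 ((g : Matrix (Fin 6) (Fin 6) ℂ).mulVec v) = Phi8 v ∧
    Phi12 ((g : Matrix (Fin 6) (Fin 6) ℂ).mulVec v) = Phi12 v ∧
    Phi12' ((g : Matrix (Fin 6) (Fin 6) ℂ).mulVec v) = Phi12' v ∧
    Phi16 ((g : Matrix (Fin 6) (Fin 6) ℂ).mulVec v) = Phi16 v ∧
    Phi18 ((g : Matrix (Fin 6) (Fin 6) ℂ).mulVec v) = Phi18 v ∧
    Phi20 ((g : Matrix (Fin 6) (Fin 6) ℂ).mulVec v) = Phi20 v ∧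
    Phi30 ((g : Matrix (Fin 6) (Fin 6) ℂ).mulVec v) = Phi30 v := by
  have hw := borelInvariant_winf.sum_slash_pow_mulVec hS hT hg
  have hδ := borelInvariant_deltaInf.sum_slash_pow_mulVec hS hT hg
  simp only [slash_winf] at hw
  simp only [slash_deltaInf] at hδ
  have hw1 := hw 1 v
  simp only [pow_one] at hw1
  simp only [Phi4, Phi8, Phi12, Phi12', Phi16, Phi18, Phi20, Phi30, hw1, hw, hδ, and_self]

end
end

section
/- Let A(z) = (a1(z), a2(z), a3(z), a4(z), a5(z), a6(z))ᵀ ∈ ℂ^6. Then for every z in the upper half-plane ℍ: A(z+1) = e^{−3πi/4} · T · A(z), and A(−1/z) = e^{πi/4} · √z · S · A(z), where √z denotes the principal square root (whose argument lies in (0, π/2) since Im z > 0). -/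
open Complex Finset

noncomputable section

local notation "ζ" => zeta13

lemma zeta13_pow_s7 (a : ℕ) : zeta13 ^ a = cexp (2 * Real.pi * I * a / 13) := by
  rw [zeta13, ← Complex.exp_nat_mul]
  congr 1
  ring

lemma exp_pi_mul_I_mul_int (n : ℤ) : cexp (Real.pi * I * n) = (-1) ^ n := by
  rw [← Complex.exp_pi_mul_I, ← Complex.exp_int_mul]
  congr 1
  ring

lemma qp_add_one (α : ℚ) (z : ℂ) :
    qp α (z + 1) = cexp (2 * Real.pi * I * α) * qp α z := by
  rw [qp, qp, ← Complex.exp_add]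
  congr 1
  ring

lemma thetaSum_add_one {c : ℤ} (hc : Odd c) (z : ℂ) : thetaSum c (z + 1) = thetaSum c z := by
  refine tsum_congr fun n => ?_
  obtain ⟨k, rfl⟩ := hc
  obtain ⟨j, hj⟩ : Even (n * (n + 1)) := Int.even_mul_succ_self n
  rw [qp_add_one, Complex.exp_eq_one_iff.mpr ⟨6 * n ^ 2 + j + k * n, ?_⟩, one_mul]
  have hj' : (n : ℂ) * (n + 1) = j + j := by exact_mod_cast hj
  push_cast
  linear_combination (Real.pi * I : ℂ) * hj'

/-- `Σ_{n∈ℤ} (−1)^n q^{(26n+c)^2/104}`, the theta constant of order 13 with characteristic `c`. -/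
def thetaConst (c : ℤ) (z : ℂ) : ℂ :=
  ∑' n : ℤ, cexp (Real.pi * I * n + Real.pi * I * z * (26 * n + c) ^ 2 / 52)

lemma qp_mul_thetaSum {α : ℚ} {c : ℤ} (hα : α = c ^ 2 / 104) (z : ℂ) :
    qp α z * thetaSum c z = thetaConst c z := by
  rw [thetaSum, thetaConst, ← tsum_mul_left]
  refine tsum_congr fun n => ?_
  rw [← exp_pi_mul_I_mul_int, qp, qp, ← Complex.exp_add, ← Complex.exp_add, hα]
  congr 1
  push_cast
  ring

lemma thetaConst_neg (c : ℤ) (z : ℂ) : thetaConst (-c) z = thetaConst c z := by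
  rw [thetaConst, ← (Equiv.neg ℤ).tsum_eq]
  refine tsum_congr fun n => ?_
  refine Complex.exp_eq_exp_iff_exists_int.mpr ⟨-n, ?_⟩
  simp only [Equiv.neg_apply]
  push_cast
  ring

lemma thetaConst_add (c : ℤ) (z : ℂ) : thetaConst (c + 26) z = -thetaConst c z := by
  rw [thetaConst, thetaConst, ← tsum_neg, ← (Equiv.subRight (1 : ℤ)).tsum_eq]
  refine tsum_congr fun n => ?_
  rw [← neg_one_mul, ← Complex.exp_pi_mul_I, ← Complex.exp_add]
  refine Complex.exp_eq_exp_iff_exists_int.mpr ⟨-1, ?_⟩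
  simp only [Equiv.subRight_apply]
  push_cast
  ring

lemma thetaConst_sub (c : ℤ) (z : ℂ) : thetaConst (26 - c) z = -thetaConst c z := by
  rw [← thetaConst_neg c, ← thetaConst_add]
  congr 1
  ring

lemma thetaConst_thirteen (z : ℂ) : thetaConst 13 z = 0 :=
  self_eq_neg.mp (thetaConst_sub 13 z)

lemma thetaConst_eq_jacobiTheta₂ (c : ℤ) (z : ℂ) :
    thetaConst c z =
      cexp (Real.pi * I * z * c ^ 2 / 52) * jacobiTheta₂ ((1 + c * z) / 2) (13 * z) := by
  rw [thetaConst, jacobiTheta₂, ← tsum_mul_left]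
  refine tsum_congr fun n => ?_
  rw [jacobiTheta₂_term, ← Complex.exp_add]
  congr 1
  ring

lemma one_div_cpow_half {z : ℂ} (hz : 0 < z.im) :
    1 / (-I * (13 * (-1 / z))) ^ (1 / 2 : ℂ) =
      z ^ ((1 : ℂ) / 2) * cexp (-(Real.pi * I / 4)) / (Real.sqrt 13 : ℂ) := by
  have hz0 : z ≠ 0 := fun h => by simp [h] at hz
  have harg : 0 < z.arg := by
    rcases (Complex.arg_nonneg_iff.mpr hz.le).lt_or_eq with h | h
    · exact h
    · exact absurd (Complex.arg_eq_zero_iff.mp h.symm).2 hz.ne'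
  have harg' : z.arg < Real.pi := Complex.arg_lt_pi_iff.mpr (Or.inr hz.ne')
  have hlog : Complex.log (I * z⁻¹) = Real.pi / 2 * I - Complex.log z := by
    rw [Complex.log_mul Complex.I_ne_zero (inv_ne_zero hz0), Complex.log_I,
      Complex.log_inv _ harg'.ne, sub_eq_add_neg]
    rw [Complex.arg_I, Complex.arg_inv, if_neg harg'.ne]
    constructor <;> linarith
  have hsqrt : (Real.sqrt 13 : ℂ) = cexp (Real.log 13 / 2) := by
    rw [Real.sqrt_eq_rpow, Real.rpow_def_of_pos (by norm_num)]
    push_cast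
    congr 1
    ring
  have hbase : -I * (13 * (-1 / z)) = (13 : ℝ) * (I * z⁻¹) := by
    push_cast
    ring
  have hne : I * z⁻¹ ≠ 0 := mul_ne_zero Complex.I_ne_zero (inv_ne_zero hz0)
  rw [hbase, Complex.cpow_def_of_ne_zero (mul_ne_zero (by norm_num) hne),
    Complex.cpow_def_of_ne_zero hz0, Complex.log_ofReal_mul (by norm_num) hne, hlog, hsqrt,
    one_div, ← Complex.exp_neg, ← Complex.exp_add, ← Complex.exp_sub]
  congr 1
  ring

/-- The general term of the series obtained from `thetaConst c (-1 / z)` by Poisson summation. -/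
def dualTerm (c : ℤ) (z : ℂ) (m : ℤ) : ℂ :=
  cexp (Real.pi * I * z * (2 * m - 1) ^ 2 / 52 + Real.pi * I * (c * (2 * m - 1)) / 26)

lemma dualTerm_eq (c : ℤ) (z : ℂ) (m : ℤ) :
    dualTerm c z m = cexp (Real.pi * I * z / 52 - Real.pi * I * c / 26) *
      jacobiTheta₂_term m ((c - z) / 26) (z / 13) := by
  rw [dualTerm, jacobiTheta₂_term, ← Complex.exp_add]
  congr 1
  ring

lemma summable_dualTerm (c : ℤ) {z : ℂ} (hz : 0 < z.im) : Summable (dualTerm c z) := by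
  simp_rw [funext (dualTerm_eq c z)]
  refine Summable.mul_left _ ((summable_jacobiTheta₂_term_iff _ _).mpr ?_)
  simpa using hz

lemma thetaConst_neg_one_div (c : ℤ) {z : ℂ} (hz : 0 < z.im) :
    thetaConst c (-1 / z) =
      z ^ ((1 : ℂ) / 2) * cexp (-(Real.pi * I / 4)) / (Real.sqrt 13 : ℂ) *
        ∑' m : ℤ, dualTerm c z m := by
  have hz0 : z ≠ 0 := fun h => by simp [h] at hz
  rw [thetaConst_eq_jacobiTheta₂, jacobiTheta₂_functional_equation, one_div_cpow_half hz]
  have h1 : (1 + c * (-1 / z)) / 2 / (13 * (-1 / z)) = (c - z) / 26 := by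
    field_simp
    ring
  have h2 : -1 / (13 * (-1 / z)) = z / 13 := by
    field_simp
  rw [h1, h2, tsum_congr (dualTerm_eq c z), tsum_mul_left, ← jacobiTheta₂, mul_left_comm,
    mul_assoc, ← mul_assoc (cexp _) (cexp _), ← Complex.exp_add]
  congr 3
  field_simp
  ring

lemma tsum_dualTerm {c : ℤ} (hc : Odd c) {z : ℂ} (hz : 0 < z.im) :
    ∑' m : ℤ, dualTerm c z m =
      ∑ r : Fin 13, cexp (Real.pi * I * (c * (2 * (r : ℕ) - 1)) / 26) *
        thetaConst (2 * (r : ℕ) - 1) z := by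
  have hs := (Int.divModEquiv 13).symm.summable_iff.mpr (summable_dualTerm c hz)
  rw [← (Int.divModEquiv 13).symm.tsum_eq, ← (Equiv.prodComm _ _).tsum_eq]
  refine (Summable.tsum_prod ((Equiv.prodComm _ _).summable_iff.mpr hs)).trans ?_
  rw [tsum_fintype]
  refine Finset.sum_congr rfl fun r _ => ?_
  rw [thetaConst, ← tsum_mul_left]
  refine tsum_congr fun n => ?_
  obtain ⟨k, rfl⟩ := hc
  simp only [Function.comp_apply, dualTerm, ← Complex.exp_add]
  refine Complex.exp_eq_exp_iff_exists_int.mpr ⟨k * n, ?_⟩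
  simp
  ring

/-- `2i·cos(πk/26)`, which is `ζ^a − ζ^(−a)` for a suitable `a` when `k` is odd. -/
def dualCoeff (k : ℤ) : ℂ := I * (cexp (Real.pi * I * k / 26) + cexp (-(Real.pi * I * k / 26)))

lemma dualCoeff_neg (k : ℤ) : dualCoeff (-k) = dualCoeff k := by
  rw [dualCoeff, dualCoeff, add_comm]
  push_cast
  congr 3 <;> ring_nf

lemma dualCoeff_eq {k : ℤ} {a b : ℕ} (ha : 52 ∣ k + 13 - 4 * a) (hb : 52 ∣ k + 13 + 4 * b) :
    dualCoeff k = zeta13 ^ a - zeta13 ^ b := by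
  obtain ⟨s, hs⟩ := ha
  obtain ⟨t, ht⟩ := hb
  have hs' : (k : ℂ) + 13 - 4 * a = 52 * s := by exact_mod_cast hs
  have ht' : (k : ℂ) + 13 + 4 * b = 52 * t := by exact_mod_cast ht
  have hI : I = cexp (Real.pi / 2 * I) := Complex.exp_pi_div_two_mul_I.symm
  have h1 : I * cexp (Real.pi * I * k / 26) = zeta13 ^ a := by
    rw [zeta13_pow_s7]
    nth_rewrite 1 [hI]
    rw [← Complex.exp_add]
    refine Complex.exp_eq_exp_iff_exists_int.mpr ⟨s, ?_⟩
    linear_combination (Real.pi * I / 26 : ℂ) * hs'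
  have h2 : I * cexp (-(Real.pi * I * k / 26)) = -zeta13 ^ b := by
    rw [zeta13_pow_s7, neg_eq_neg_one_mul (cexp _), ← Complex.exp_pi_mul_I]
    nth_rewrite 1 [hI]
    rw [← Complex.exp_add, ← Complex.exp_add]
    refine Complex.exp_eq_exp_iff_exists_int.mpr ⟨-t, ?_⟩
    push_cast
    linear_combination (-(Real.pi * I / 26) : ℂ) * ht'
  rw [dualCoeff, mul_add, h1, h2, sub_eq_add_neg]

lemma dualCoeff_eq_of_neg {k : ℤ} {a b : ℕ} (ha : 52 ∣ -k + 13 - 4 * a)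
    (hb : 52 ∣ -k + 13 + 4 * b) : dualCoeff k = zeta13 ^ a - zeta13 ^ b := by
  rw [← dualCoeff_neg, dualCoeff_eq ha hb]

/-- The characteristics of the theta constants `a_1, …, a_6`; the fourth one is `23`, not `3`,
to account for the sign in the definition of `a_4`. -/
def thetaChar : Fin 6 → ℤ := ![11, 7, 5, 23, 9, 1]

lemma odd_thetaChar (i : Fin 6) : Odd (thetaChar i) := by
  fin_cases i <;> decide

lemma Avec_apply (z : ℂ) (i : Fin 6) : Avec z i = thetaConst (thetaChar i) z := by
  fin_cases i
  · exact qp_mul_thetaSum (by norm_num) z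
  · exact qp_mul_thetaSum (by norm_num) z
  · exact qp_mul_thetaSum (by norm_num) z
  · exact (congrArg Neg.neg (qp_mul_thetaSum (by norm_num) z)).trans (thetaConst_sub 3 z).symm
  · exact qp_mul_thetaSum (by norm_num) z
  · exact qp_mul_thetaSum (by norm_num) z

lemma I_mul_tsum_dualTerm {c : ℤ} (hc : Odd c) {z : ℂ} (hz : 0 < z.im) :
    I * ∑' m : ℤ, dualTerm c z m =
      ∑ j, dualCoeff (c * thetaChar j) * thetaConst (thetaChar j) z := by
  have hpair : ∀ j : ℂ, cexp (Real.pi * I * (c * (26 - j)) / 26) =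
      -cexp (-(Real.pi * I * (c * j) / 26)) := fun j => by
    obtain ⟨k, rfl⟩ := hc
    rw [← neg_one_mul, ← Complex.exp_pi_mul_I, ← Complex.exp_add]
    refine Complex.exp_eq_exp_iff_exists_int.mpr ⟨k, ?_⟩
    push_cast
    ring
  have h1 := thetaConst_neg 1 z
  have h5 := thetaConst_sub 5 z
  have h7 := thetaConst_sub 7 z
  have h9 := thetaConst_sub 9 z
  have h11 := thetaConst_sub 11 z
  have h23 := thetaConst_sub 23 z
  have e5 := hpair 5
  have e7 := hpair 7
  have e9 := hpair 9
  have e11 := hpair 11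
  have e23 := hpair 23
  norm_num at h1 h5 h7 h9 h11 h23 e5 e7 e9 e11 e23
  rw [tsum_dualTerm hc hz]
  rw [Fin.sum_univ_six]
  simp only [Fin.sum_univ_succ, dualCoeff, thetaChar, Matrix.cons_val]
  norm_num [thetaConst_thirteen, h1, h5, h7, h9, h11, h23, e5, e7, e9, e11, e23]
  ring_nf

lemma Smat_apply (i j : Fin 6) :
    Smat i j = -(1 / (Real.sqrt 13 : ℂ)) * dualCoeff (thetaChar i * thetaChar j) := by
  rw [Smat, Matrix.smul_apply, smul_eq_mul]
  congr 1
  symm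
  have hfst {k : ℤ} {b : ℕ} (h : dualCoeff k = zeta13 ^ 1 - zeta13 ^ b) :
      dualCoeff k = zeta13 - zeta13 ^ b := by
    rw [h, pow_one]
  have hsnd {k : ℤ} {a : ℕ} (h : dualCoeff k = zeta13 ^ a - zeta13 ^ 1) :
      dualCoeff k = zeta13 ^ a - zeta13 := by
    rw [h, pow_one]
  fin_cases i <;> fin_cases j <;>
    first
    | exact dualCoeff_eq (by decide) (by decide)
    | exact dualCoeff_eq_of_neg (by decide) (by decide)
    | exact hfst (dualCoeff_eq_of_neg (by decide) (by decide))
    | exact hsnd (dualCoeff_eq (by decide) (by decide))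
    | exact hsnd (dualCoeff_eq_of_neg (by decide) (by decide))

lemma exp_neg_pi_div_four : cexp (-(Real.pi * I / 4)) = -(cexp (Real.pi * I / 4) * I) := by
  have h : cexp (Real.pi * I / 4) * I = cexp (Real.pi * I / 4 + Real.pi / 2 * I) := by
    rw [Complex.exp_add, Complex.exp_pi_div_two_mul_I]
  rw [h, neg_eq_neg_one_mul (cexp _), ← Complex.exp_pi_mul_I, ← Complex.exp_add]
  refine Complex.exp_eq_exp_iff_exists_int.mpr ⟨-1, ?_⟩
  push_cast
  ring

lemma qp_mul_thetaSum_add_one {α : ℚ} {c : ℤ} (hc : Odd c) {a : ℕ} (m : ℤ)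
    (hα : α = a / 13 - 3 / 8 + m) (z : ℂ) :
    qp α (z + 1) * thetaSum c (z + 1) =
      cexp (-(3 * Real.pi * I) / 4) * (zeta13 ^ a * (qp α z * thetaSum c z)) := by
  rw [thetaSum_add_one hc, qp_add_one, zeta13_pow_s7, ← mul_assoc, ← Complex.exp_add, mul_assoc]
  congr 1
  refine Complex.exp_eq_exp_iff_exists_int.mpr ⟨m, ?_⟩
  rw [hα]
  push_cast
  ring

lemma Avec_add_one (z : ℂ) :
    Avec (z + 1) = Complex.exp (-(3 * Real.pi * Complex.I) / 4) • Tmat.mulVec (Avec z) := by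
  ext i
  rw [Pi.smul_apply, Tmat, Matrix.mulVec_diagonal, smul_eq_mul]
  fin_cases i
  · exact qp_mul_thetaSum_add_one (a := 7) (by decide) 1 (by norm_num) z
  · exact qp_mul_thetaSum_add_one (a := 11) (by decide) 0 (by norm_num) z
  · exact qp_mul_thetaSum_add_one (a := 8) (by decide) 0 (by norm_num) z
  · have h := qp_mul_thetaSum_add_one (α := 9 / 104) (c := 3) (a := 6) (by decide) 0 (by norm_num) z
    simp [Avec, thc, h]
  · exact qp_mul_thetaSum_add_one (a := 2) (by decide) 1 (by norm_num) z
  · exact qp_mul_thetaSum_add_one (a := 5) (by decide) 0 (by norm_num) z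

lemma Avec_neg_one_div {z : ℂ} (hz : 0 < z.im) :
    Avec (-1 / z) =
      (Complex.exp (Real.pi * Complex.I / 4) * z ^ ((1 : ℂ) / 2)) • Smat.mulVec (Avec z) := by
  ext i
  have h := I_mul_tsum_dualTerm (odd_thetaChar i) hz
  simp only [Pi.smul_apply, Matrix.mulVec, dotProduct, smul_eq_mul, Smat_apply, mul_assoc,
    ← Finset.mul_sum, Avec_apply, ← h]
  rw [thetaConst_neg_one_div _ hz, exp_neg_pi_div_four]
  ring

/-- `A(z+1) = e^{−3πi/4}·T·A(z)` and `A(−1/z) = e^{πi/4}·√z·S·A(z)` on ℍ,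
where `√z = z^{1/2}` is the principal square root. -/
theorem stmt_7 (z : ℂ) (hz : 0 < z.im) :
    Avec (z + 1) = Complex.exp (-(3 * Real.pi * Complex.I) / 4) • Tmat.mulVec (Avec z) ∧
    Avec (-1 / z) =
      (Complex.exp (Real.pi * Complex.I / 4) * z ^ ((1 : ℂ) / 2)) • Smat.mulVec (Avec z) := by
  exact ⟨Avec_add_one z, Avec_neg_one_div hz⟩

end
end

section
/- For every γ = (a b; c d) ∈ SL(2, ℤ) with a ≡ d ≡ 1 (mod 13) and b ≡ c ≡ 0 (mod 13), there exists u ∈ ℂ with u³ = 1 such that for all z in the upper half-plane ℍ and all i ∈ {1,…,6}: x_i((az+b)/(cz+d)) = u·(cz+d)·x_i(z). In other words, x1,…,x6 are modular forms of weight one for the principal congruence subgroup Γ(13) with a common cube-root-of-unity multiplier. -/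
open Complex Finset

noncomputable section

local notation "ζ" => zeta13

/-- The finite product `(q; q)_n = ∏_{i < n} (1 - q ^ (i + 1))`. -/
def qPoch (q : ℂ) (n : ℕ) : ℂ := ∏ i ∈ range n, (1 - q ^ (i + 1))

/-- The Gaussian binomial coefficient, defined by its Pascal-type recursion. -/
def gaussBinom (q : ℂ) : ℕ → ℕ → ℂ
  | _, 0 => 1
  | 0, _ + 1 => 0
  | M + 1, j + 1 => q ^ (j + 1) * gaussBinom q M (j + 1) + gaussBinom q M j

lemma gaussBinom_zero_right (q : ℂ) (M : ℕ) : gaussBinom q M 0 = 1 := by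
  cases M <;> rfl

lemma gaussBinom_eq_zero_of_lt (q : ℂ) {M j : ℕ} (h : M < j) : gaussBinom q M j = 0 := by
  induction M generalizing j with
  | zero => obtain ⟨j, rfl⟩ := Nat.exists_eq_succ_of_ne_zero h.ne'; rfl
  | succ M ih =>
    obtain ⟨j, rfl⟩ := Nat.exists_eq_succ_of_ne_zero (Nat.ne_zero_of_lt h)
    simp [gaussBinom, ih (show M < j + 1 by lia), ih (show M < j by lia)]

lemma gaussBinom_mul_qPoch (q : ℂ) (j l : ℕ) :
    gaussBinom q (j + l) j * (qPoch q j * qPoch q l) = qPoch q (j + l) := by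
  induction h : j + l generalizing j l with
  | zero =>
    obtain ⟨rfl, rfl⟩ : j = 0 ∧ l = 0 := by lia
    simp [gaussBinom, qPoch]
  | succ M ih =>
    rcases j with _ | j
    · obtain rfl : l = M + 1 := by lia
      simp [gaussBinom_zero_right, qPoch]
    · rcases l with _ | l
      · obtain rfl : j = M := by lia
        have h1 := ih j 0 (by lia)
        have h0 : qPoch q 0 = 1 := by simp [qPoch]
        rw [h0, mul_one] at h1 ⊢
        rw [gaussBinom, gaussBinom_eq_zero_of_lt q (Nat.lt_succ_self j), mul_zero, zero_add,
          qPoch, prod_range_succ, ← qPoch, ← mul_assoc, h1]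
      · have h1 := ih (j + 1) l (by lia)
        have h2 := ih j (l + 1) (by lia)
        have hs : ∀ n, qPoch q (n + 1) = qPoch q n * (1 - q ^ (n + 1)) := fun n ↦
          prod_range_succ _ _
        have hq : q ^ (M + 1) = q ^ (j + 1) * q ^ (l + 1) := by rw [← pow_add]; congr 1; lia
        rw [gaussBinom, hs M, hq]
        rw [hs j] at h1 ⊢
        rw [hs l] at h2 ⊢
        linear_combination q ^ (j + 1) * (1 - q ^ (l + 1)) * h1 + (1 - q ^ (j + 1)) * h2

/-- The finite `q`-binomial theorem. -/
lemma prod_one_add_mul_pow (q x : ℂ) (M : ℕ) :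
    ∏ i ∈ range M, (1 + x * q ^ i) =
      ∑ j ∈ range (M + 1), q ^ (j.choose 2) * gaussBinom q M j * x ^ j := by
  induction M generalizing x with
  | zero => simp [gaussBinom]
  | succ M ih =>
    rw [prod_range_succ', sum_range_succ']
    have h1 : ∏ i ∈ range M, (1 + x * q ^ (i + 1)) = ∏ i ∈ range M, (1 + x * q * q ^ i) :=
      prod_congr rfl fun i _ ↦ by ring
    have h2 : ∀ j, q ^ ((j + 1).choose 2) * gaussBinom q (M + 1) (j + 1) * x ^ (j + 1) =
        q ^ ((j + 1).choose 2) * gaussBinom q M (j + 1) * (x * q) ^ (j + 1) +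
          x * (q ^ (j.choose 2) * gaussBinom q M j * (x * q) ^ j) := fun j ↦ by
      have : (j + 1).choose 2 = j + j.choose 2 := by
        simp [Nat.choose_succ_succ' j 1]
      rw [gaussBinom, this]
      ring
    simp_rw [h1, ih, h2, sum_add_distrib, ← mul_sum]
    have h3 := sum_range_succ' (fun j ↦ q ^ (j.choose 2) * gaussBinom q M j * (x * q) ^ j) (M + 1)
    rw [sum_range_succ, gaussBinom_eq_zero_of_lt q (Nat.lt_succ_self M)] at h3
    simp only [gaussBinom_zero_right] at h3 ⊢
    linear_combination h3

/-- The finite form of the Jacobi triple product identity. -/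
lemma prod_mul_prod_eq_sum_gaussBinom {q x : ℂ} (hq : q ≠ 0) (hx : x ≠ 0) (N : ℕ) :
    (∏ i ∈ range N, (1 - x * q ^ (i + 1))) * ∏ i ∈ range N, (1 - q ^ i / x) =
      ∑ j ∈ range (2 * N + 1), (-x) ^ ((j : ℤ) - N) *
        q ^ (((j : ℤ) - N) * ((j : ℤ) - N + 1) / 2) * gaussBinom q (2 * N) j := by
  have h := prod_one_add_mul_pow q (-x * q ^ (1 - N : ℤ)) (2 * N)
  have h1 : ∏ i ∈ range (2 * N), (1 + -x * q ^ (1 - N : ℤ) * q ^ i) =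
      ((∏ i ∈ range N, (1 - x * q ^ (i + 1))) * ∏ i ∈ range N, (1 - q ^ i / x)) *
        ∏ i ∈ range N, (-x * q ^ (-i : ℤ)) := by
    rw [two_mul, prod_range_add, mul_comm (∏ i ∈ range N, _), mul_assoc,
      ← prod_range_reflect (fun i ↦ 1 + -x * q ^ (1 - N : ℤ) * q ^ i),
      ← prod_mul_distrib, ← prod_mul_distrib, ← prod_mul_distrib]
    refine prod_congr rfl fun i hi ↦ congrArg₂ (· * ·) ?_ ?_
    · rw [mul_assoc, ← zpow_natCast q (N + i), ← zpow_add₀ hq, ← zpow_natCast q (i + 1)]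
      push_cast
      ring_nf
    · have hi := mem_range.1 hi
      rw [mul_assoc (-x), ← zpow_natCast q (N - 1 - i), ← zpow_add₀ hq,
        show (1 - N : ℤ) + (N - 1 - i : ℕ) = -i by lia, zpow_neg, zpow_natCast]
      field_simp
      ring
  have h2 : ∏ i ∈ range N, (-x * q ^ (-i : ℤ)) = (-x) ^ N * q ^ (-(N.choose 2 : ℤ)) := by
    rw [prod_mul_distrib, prod_const, card_range]
    congr 1
    clear h h1
    induction N with
    | zero => simp
    | succ N ih =>
      rw [prod_range_succ, ih, ← zpow_add₀ hq, Nat.choose_succ_succ' N 1]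
      simp
  have h3 : (-x) ^ N * q ^ (-(N.choose 2 : ℤ)) ≠ 0 :=
    mul_ne_zero (pow_ne_zero _ (neg_ne_zero.2 hx)) (zpow_ne_zero _ hq)
  rw [h1, h2] at h
  rw [← mul_left_inj' h3, h, sum_mul]
  refine sum_congr rfl fun j _ ↦ ?_
  have h4 : (j.choose 2 : ℤ) + (1 - N) * j =
      ((j : ℤ) - N) * ((j : ℤ) - N + 1) / 2 + -(N.choose 2 : ℤ) := by
    have e (n : ℕ) : (n.choose 2 : ℤ) * 2 = n * (n - 1) := by
      have h := Nat.cast_choose_two ℚ n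
      have : ((n.choose 2 : ℤ) * 2 : ℚ) = ((n * (n - 1) : ℤ) : ℚ) := by
        push_cast
        rw [h]
        ring
      exact_mod_cast this
    obtain ⟨t, ht⟩ := Int.even_mul_succ_self ((j : ℤ) - N)
    have := e j
    have := e N
    rw [ht, ← two_mul, Int.mul_ediv_cancel_left _ two_ne_zero]
    nlinarith
  have h5 : q ^ (j.choose 2) * (-x * q ^ (1 - N : ℤ)) ^ j =
      (-x) ^ j * q ^ ((j.choose 2 : ℤ) + (1 - N) * j) := by
    rw [mul_pow, zpow_add₀ hq, zpow_mul, zpow_natCast, zpow_natCast]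
    ring
  have h6 : (-x) ^ ((j : ℤ) - N) * (-x) ^ N = (-x) ^ j := by
    rw [← zpow_natCast, ← zpow_add₀ (neg_ne_zero.2 hx), sub_add_cancel, zpow_natCast]
  rw [mul_right_comm, h5, h4, zpow_add₀ hq, ← h6]
  ring

lemma tendsto_prod_range_tprod_one_sub_mul_pow {q : ℂ} (hq : ‖q‖ < 1) (y : ℂ) :
    Filter.Tendsto (fun N ↦ ∏ i ∈ range N, (1 - y * q ^ i)) Filter.atTop
      (nhds (∏' n : ℕ, (1 - y * q ^ n))) := by
  refine Multipliable.tendsto_prod_tprod_nat ?_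
  simp_rw [sub_eq_add_neg]
  refine multipliable_one_add_of_summable ?_
  simpa using (summable_geometric_of_lt_one (norm_nonneg _) hq).mul_left ‖y‖

lemma tendsto_qPoch {q : ℂ} (hq : ‖q‖ < 1) :
    Filter.Tendsto (qPoch q) Filter.atTop (nhds (∏' n : ℕ, (1 - q ^ (n + 1)))) :=
  (ModularForm.multipliable_one_sub_pow hq).tendsto_prod_tprod_nat

lemma one_sub_pow_succ_ne_zero {q : ℂ} (hq : ‖q‖ < 1) (n : ℕ) : 1 - q ^ (n + 1) ≠ 0 := by
  intro h
  have h1 : ‖q ^ (n + 1)‖ < 1 := by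
    rw [norm_pow]
    exact pow_lt_one₀ (norm_nonneg _) hq (by simp)
  rw [← sub_eq_zero.1 h] at h1
  simp at h1

lemma qPoch_ne_zero {q : ℂ} (hq : ‖q‖ < 1) (n : ℕ) : qPoch q n ≠ 0 :=
  prod_ne_zero_iff.2 fun i _ ↦ one_sub_pow_succ_ne_zero hq i

lemma tprod_one_sub_pow_succ_ne_zero {q : ℂ} (hq : ‖q‖ < 1) :
    ∏' n : ℕ, (1 - q ^ (n + 1)) ≠ 0 := by
  simp_rw [sub_eq_add_neg]
  refine tprod_one_add_ne_zero_of_summable (fun n ↦ ?_) ?_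
  · simpa [← sub_eq_add_neg] using one_sub_pow_succ_ne_zero hq n
  · simpa using (summable_nat_add_iff 1).mpr (summable_geometric_of_lt_one (norm_nonneg _) hq)

/-- The **Jacobi triple product** identity. -/
lemma tsum_eq_jacobi_triple_product {q x : ℂ} (hq : q ≠ 0) (hq1 : ‖q‖ < 1) (hx : x ≠ 0)
    (hs : Summable fun n : ℤ ↦ ‖(-x) ^ n * q ^ (n * (n + 1) / 2)‖) :
    ∑' n : ℤ, (-x) ^ n * q ^ (n * (n + 1) / 2) =
      (∏' n : ℕ, (1 - q ^ (n + 1))) *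
        ((∏' n : ℕ, (1 - x * q * q ^ n)) * ∏' n : ℕ, (1 - x⁻¹ * q ^ n)) := by
  set P := ∏' n : ℕ, (1 - q ^ (n + 1)) with hP
  have hP0 : P ≠ 0 := tprod_one_sub_pow_succ_ne_zero hq1
  set f : ℤ → ℂ := fun n ↦ (-x) ^ n * q ^ (n * (n + 1) / 2) with hf
  set g : ℕ → ℤ → ℂ := fun N n ↦
    if -(N : ℤ) ≤ n ∧ n ≤ N then gaussBinom q (2 * N) (n + N).toNat else 0 with hg
  have hgq (N : ℕ) (n : ℤ) (h : -(N : ℤ) ≤ n ∧ n ≤ N) :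
      g N n = qPoch q (2 * N) * ((qPoch q (n + N).toNat)⁻¹ * (qPoch q (N - n).toNat)⁻¹) := by
    have h1 := gaussBinom_mul_qPoch q (n + N).toNat (N - n).toNat
    rw [show (n + N).toNat + (N - n).toNat = 2 * N by lia] at h1
    rw [← h1]
    have := qPoch_ne_zero hq1 (n + N).toNat
    have := qPoch_ne_zero hq1 (N - n).toNat
    simp only [hg, if_pos h]
    field_simp
  have hinv := (tendsto_qPoch hq1).inv₀ hP0
  obtain ⟨B, hB⟩ := (tendsto_qPoch hq1).norm.bddAbove_range
  obtain ⟨C, hC⟩ := hinv.norm.bddAbove_range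
  have hB' (n : ℕ) : ‖qPoch q n‖ ≤ B := hB ⟨n, rfl⟩
  have hC' (n : ℕ) : ‖(qPoch q n)⁻¹‖ ≤ C := hC ⟨n, rfl⟩
  have hB0 : 0 ≤ B := (norm_nonneg _).trans (hB' 0)
  have hC0 : 0 ≤ C := (norm_nonneg _).trans (hC' 0)
  have hlim : Filter.Tendsto (fun N ↦ ∑' n, f n * g N n) Filter.atTop
      (nhds (∑' n, f n * (P * (P⁻¹ * P⁻¹)))) := by
    refine tendsto_tsum_of_dominated_convergence (hs.mul_right (B * (C * C))) (fun n ↦ ?_)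
      (.of_forall fun N n ↦ ?_)
    · refine Filter.Tendsto.const_mul _ ?_
      have t1 : Filter.Tendsto (fun N : ℕ ↦ 2 * N) Filter.atTop Filter.atTop :=
        Filter.tendsto_atTop_atTop.2 fun b ↦ ⟨b, fun a ha ↦ by lia⟩
      have t2 : Filter.Tendsto (fun N : ℕ ↦ (n + N).toNat) Filter.atTop Filter.atTop :=
        Filter.tendsto_atTop_atTop.2 fun b ↦ ⟨b + n.natAbs, fun a ha ↦ by lia⟩
      have t3 : Filter.Tendsto (fun N : ℕ ↦ (N - n).toNat) Filter.atTop Filter.atTop :=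
        Filter.tendsto_atTop_atTop.2 fun b ↦ ⟨b + n.natAbs, fun a ha ↦ by lia⟩
      refine (((tendsto_qPoch hq1).comp t1).mul
        ((hinv.comp t2).mul (hinv.comp t3))).congr' ?_
      filter_upwards [Filter.eventually_ge_atTop n.natAbs] with N hN
      exact (hgq N n (by lia)).symm
    · rw [norm_mul]
      refine mul_le_mul_of_nonneg_left ?_ (norm_nonneg _)
      by_cases h : -(N : ℤ) ≤ n ∧ n ≤ N
      · rw [hgq N n h, norm_mul, norm_mul]
        gcongr
        exacts [hB' _, hC' _, hC' _]
      · simp only [hg, if_neg h, norm_zero]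
        positivity
  have hfin (N : ℕ) : ∑' n, f n * g N n =
      (∏ i ∈ range N, (1 - x * q * q ^ i)) * ∏ i ∈ range N, (1 - x⁻¹ * q ^ i) := by
    rw [tsum_eq_sum (s := Icc (-(N : ℤ)) N) fun n hn ↦ by
      simp only [hg, if_neg (mt mem_Icc.2 hn), mul_zero]]
    have h := prod_mul_prod_eq_sum_gaussBinom hq hx N
    have e1 : ∀ i, x * q * q ^ i = x * q ^ (i + 1) := fun i ↦ by ring
    have e2 : ∀ i, x⁻¹ * q ^ i = q ^ i / x := fun i ↦ by ring
    simp_rw [e1, e2, h]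
    symm
    refine sum_bij (fun j _ ↦ (j : ℤ) - N) (fun j hj ↦ ?_) (fun i _ j _ h ↦ by lia)
      (fun n hn ↦ ⟨(n + N).toNat, ?_, ?_⟩) fun j hj ↦ ?_
    · rw [mem_range] at hj
      rw [mem_Icc]
      lia
    · rw [mem_Icc] at hn
      rw [mem_range]
      lia
    · rw [mem_Icc] at hn
      lia
    · rw [mem_range] at hj
      simp only [hf, hg]
      rw [if_pos (by lia), sub_add_cancel, Int.toNat_natCast]
  have hlim' := ((tendsto_prod_range_tprod_one_sub_mul_pow hq1 (x * q)).mul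
    (tendsto_prod_range_tprod_one_sub_mul_pow hq1 x⁻¹)).congr fun N ↦ (hfin N).symm
  have h := tendsto_nhds_unique hlim' hlim
  rw [h, tsum_mul_right]
  field_simp

lemma jacobiTheta₂_add_one_right (z τ : ℂ) :
    jacobiTheta₂ z (τ + 1) = jacobiTheta₂ (z + 1 / 2) τ := by
  refine tsum_congr fun n ↦ ?_
  obtain ⟨m, hm⟩ := Int.even_mul_succ_self (n - 1)
  have hn : (n : ℂ) ^ 2 = n + 2 * m := by
    have : n ^ 2 = n + 2 * m := by linarith
    exact_mod_cast this
  rw [jacobiTheta₂_term, jacobiTheta₂_term, Complex.exp_eq_exp_iff_exists_int]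
  exact ⟨m, by linear_combination (Real.pi * I : ℂ) * hn⟩

lemma eta_add_one (τ : ℂ) :
    ModularForm.eta (τ + 1) = cexp (Real.pi * I / 12) * ModularForm.eta τ := by
  have h : cexp (2 * Real.pi * I * (τ + 1)) = cexp (2 * Real.pi * I * τ) := by
    rw [mul_add, mul_one, Complex.exp_add, Complex.exp_two_pi_mul_I, mul_one]
  simp_rw [ModularForm.eta, ModularForm.eta_q_eq_pow, h, Function.Periodic.qParam, ← mul_assoc,
    ← Complex.exp_add]
  congr 2
  push_cast
  ring

lemma sqrt_eq_sqrt_I_mul {τ : ℂ} (hτ : 0 < τ.im) :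
    sqrt τ = sqrt I * (-I * τ) ^ (1 / 2 : ℂ) := by
  have h0 : -I * τ ≠ 0 := by
    rintro h
    have : τ = 0 := by simpa using h
    simp [this] at hτ
  have hre : 0 < (-I * τ).re := by simpa using hτ
  have harg := Complex.abs_arg_lt_pi_div_two_iff.2 (Or.inl hre)
  rw [abs_lt] at harg
  have hpi := Real.pi_pos
  have e : τ = I * (-I * τ) := by linear_combination τ * I_mul_I
  have hlog : log τ = log I + log (-I * τ) := by
    nth_rewrite 1 [e]
    refine (log_mul_eq_add_log_iff I_ne_zero h0).2 ?_
    rw [arg_I]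
    constructor <;> linarith
  have hτ0 : τ ≠ 0 := by rintro rfl; simp at hτ
  rw [sqrt_eq_exp hτ0, sqrt_eq_exp I_ne_zero, cpow_def_of_ne_zero h0, ← Complex.exp_add, hlog]
  ring_nf

/-- The Klein form `e^{πi r(rτ + s)} ϑ₁(rτ + s, τ) / η(τ)³`, up to a constant factor. -/
def klein (r s τ : ℂ) : ℂ :=
  cexp (Real.pi * I * (r * (r * τ + s) + (r * τ + s) + τ / 4)) *
    jacobiTheta₂ (r * τ + s + τ / 2 + 1 / 2) τ / ModularForm.eta τ ^ 3

lemma klein_add_one (r s τ : ℂ) : klein r s (τ + 1) = klein r (r + s) τ := by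
  have h : cexp (Real.pi * I / 12) ^ 3 = cexp (Real.pi * I / 4) := by
    rw [← Complex.exp_nat_mul]
    congr 1
    push_cast
    ring
  have h1 : r * (τ + 1) + s + (τ + 1) / 2 + 1 / 2 + 1 / 2 =
      r * τ + (r + s) + τ / 2 + 1 / 2 + 1 := by ring
  have h2 : cexp (Real.pi * I * (r * (r * (τ + 1) + s) + (r * (τ + 1) + s) + (τ + 1) / 4)) =
      cexp (Real.pi * I / 4) *
        cexp (Real.pi * I * (r * (r * τ + (r + s)) + (r * τ + (r + s)) + τ / 4)) := by
    rw [← Complex.exp_add]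
    congr 1
    ring
  rw [klein, klein, jacobiTheta₂_add_one_right, h1, jacobiTheta₂_add_left, eta_add_one, mul_pow, h,
    h2, mul_assoc, mul_div_mul_left _ _ (Complex.exp_ne_zero _)]

lemma eta_neg_inv {τ : ℂ} (hτ : 0 < τ.im) :
    ModularForm.eta (-1 / τ) = (-I * τ) ^ (1 / 2 : ℂ) * ModularForm.eta τ := by
  have heta : ModularForm.eta (-1 / τ) = (sqrt I)⁻¹ * (sqrt τ * ModularForm.eta τ) :=
    ModularForm.eta_comp_eq_csqrt_I_inv hτ
  have hI : sqrt I ≠ 0 := by simp [sqrt]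
  rwa [sqrt_eq_sqrt_I_mul hτ, ← mul_assoc, ← mul_assoc, inv_mul_cancel₀ hI, one_mul] at heta

lemma klein_neg_inv (r s : ℂ) {τ : ℂ} (hτ : 0 < τ.im) :
    klein r s (-1 / τ) * τ = klein s (-r) τ := by
  have hτ0 : τ ≠ 0 := by rintro rfl; simp at hτ
  have heta := eta_neg_inv hτ
  have hη := ModularForm.eta_ne_zero hτ
  set w := (-I * τ) ^ (1 / 2 : ℂ) with hw
  have hw0 : w ≠ 0 := by
    have : -I * τ ≠ 0 := by simpa using hτ0
    simp [hw, Complex.cpow_eq_zero_iff, hτ0]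
  have hw2 : w ^ 2 = -I * τ := by
    rw [hw, ← Complex.cpow_nat_mul]
    norm_num
  have hθ := jacobiTheta₂_functional_equation (s * τ - r + τ / 2 - 1 / 2) τ
  rw [← jacobiTheta₂_add_left, ← hw] at hθ
  have h1 : (s * τ - r + τ / 2 - 1 / 2) / τ = r * (-1 / τ) + s + (-1 / τ) / 2 + 1 / 2 := by
    field_simp
    ring
  have h2 : s * τ - r + τ / 2 - 1 / 2 + 1 = s * τ + -r + τ / 2 + 1 / 2 := by ring
  rw [h1, h2] at hθ
  rw [klein, klein, hθ, heta]
  have h3 : cexp (Real.pi * I * (r * (r * (-1 / τ) + s) + (r * (-1 / τ) + s) + -1 / τ / 4)) =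
      -I * (cexp (Real.pi * I * (s * (s * τ + -r) + (s * τ + -r) + τ / 4)) *
        cexp (-Real.pi * I * (s * τ - r + τ / 2 - 1 / 2) ^ 2 / τ)) := by
    have hI : -I = cexp (-(Real.pi / 2 * I)) := by
      rw [Complex.exp_neg, Complex.exp_pi_div_two_mul_I, Complex.inv_I]
    rw [hI, ← Complex.exp_add, ← Complex.exp_add]
    congr 1
    field_simp
    ring
  rw [h3]
  field_simp
  rw [hw2]
  ring

lemma klein_add_left (r s τ : ℂ) :
    klein (r + 1) s τ = -cexp (-(Real.pi * I * s)) * klein r s τ := by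
  have h1 : (r + 1) * τ + s + τ / 2 + 1 / 2 = r * τ + s + τ / 2 + 1 / 2 + τ := by ring
  have h2 : -cexp (-(Real.pi * I * s)) = cexp (Real.pi * I + -(Real.pi * I * s)) := by
    rw [Complex.exp_add, Complex.exp_pi_mul_I, neg_one_mul]
  rw [klein, klein, h1, jacobiTheta₂_add_left', h2, mul_div_assoc, mul_div_assoc,
    mul_div_assoc, ← mul_assoc, ← mul_assoc, ← Complex.exp_add, ← Complex.exp_add]
  congr 1
  rw [Complex.exp_eq_exp_iff_exists_int]
  exact ⟨-1, by push_cast; ring⟩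

lemma klein_add_right (r s τ : ℂ) :
    klein r (s + 1) τ = -cexp (Real.pi * I * r) * klein r s τ := by
  have h1 : r * τ + (s + 1) + τ / 2 + 1 / 2 = r * τ + s + τ / 2 + 1 / 2 + 1 := by ring
  rw [klein, klein, h1, jacobiTheta₂_add_left, ← neg_one_mul, ← Complex.exp_pi_mul_I,
    mul_div_assoc, mul_div_assoc, ← mul_assoc, ← Complex.exp_add, ← Complex.exp_add]
  congr 2
  ring


lemma klein_add_intCast_left (r s τ : ℂ) (m : ℤ) :
    klein (r + m) s τ = cexp (Real.pi * I * (m - m * s)) * klein r s τ := by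
  have key (m : ℤ) : klein (r + (m + 1 : ℤ)) s τ =
      cexp (Real.pi * I * (1 - s)) * klein (r + m) s τ := by
    rw [Int.cast_add, Int.cast_one, ← add_assoc, klein_add_left, mul_sub, mul_one, sub_eq_add_neg,
      Complex.exp_add, Complex.exp_pi_mul_I, neg_one_mul]
  induction m with
  | zero => simp
  | succ m ih =>
    rw [key, ih, ← mul_assoc, ← Complex.exp_add]
    congr 2
    push_cast
    ring
  | pred m ih =>
    have h := key (-m - 1)
    rw [sub_add_cancel, ih] at h
    rw [← mul_right_inj' (Complex.exp_ne_zero (Real.pi * I * (1 - s))), ← h, ← mul_assoc,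
      ← Complex.exp_add]
    congr 2
    push_cast
    ring

lemma klein_add_intCast_right (r s τ : ℂ) (n : ℤ) :
    klein r (s + n) τ = cexp (Real.pi * I * (n + n * r)) * klein r s τ := by
  have key (n : ℤ) : klein r (s + (n + 1 : ℤ)) τ =
      cexp (Real.pi * I * (1 + r)) * klein r (s + n) τ := by
    rw [Int.cast_add, Int.cast_one, ← add_assoc, klein_add_right, mul_add, mul_one,
      Complex.exp_add, Complex.exp_pi_mul_I, neg_one_mul]
  induction n with
  | zero => simp
  | succ n ih =>
    rw [key, ih, ← mul_assoc, ← Complex.exp_add]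
    congr 2
    push_cast
    ring
  | pred n ih =>
    have h := key (-n - 1)
    rw [sub_add_cancel, ih] at h
    rw [← mul_right_inj' (Complex.exp_ne_zero (Real.pi * I * (1 + r))), ← h, ← mul_assoc,
      ← Complex.exp_add]
    congr 2
    push_cast
    ring

lemma denom_mul_eq (x y : Matrix.SpecialLinearGroup (Fin 2) ℤ) (τ : UpperHalfPlane) :
    UpperHalfPlane.denom ↑(x * y) τ =
      UpperHalfPlane.denom x ↑(y • τ) * UpperHalfPlane.denom y τ := by
  have hy := UpperHalfPlane.denom_ne_zero y τ
  simp only [ModularGroup.denom_apply] at hy ⊢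
  rw [UpperHalfPlane.coe_specialLinearGroup_apply]
  simp only [algebraMap_int_eq, eq_intCast, Complex.ofReal_intCast]
  simp only [Matrix.SpecialLinearGroup.coe_mul, Matrix.mul_apply, Fin.sum_univ_two]
  push_cast
  field_simp
  ring

lemma denom_T (τ : UpperHalfPlane) : UpperHalfPlane.denom ModularGroup.T τ = 1 := by
  rw [ModularGroup.denom_apply]
  simp [ModularGroup.T]

/-- The Klein forms are modular of weight `-1`. -/
lemma klein_smul (M : Matrix.SpecialLinearGroup (Fin 2) ℤ) :
    ∀ (r s : ℂ) (τ : UpperHalfPlane),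
      klein r s ↑(M • τ) * UpperHalfPlane.denom M τ =
        klein (r * M 0 0 + s * M 1 0) (r * M 0 1 + s * M 1 1) τ := by
  have hM : M ∈ Subgroup.closure {ModularGroup.S, ModularGroup.T} := by
    simp [SpecialLinearGroup.SL2Z_generators]
  induction hM using Subgroup.closure_induction with
  | mem x hx =>
    intro r s τ
    rcases hx with rfl | rfl
    · have := klein_neg_inv r s τ.im_pos
      rw [UpperHalfPlane.modular_S_smul, ModularGroup.denom_S]
      simpa [ModularGroup.S, neg_div] using this
    · have := klein_add_one r s τ
      rw [UpperHalfPlane.modular_T_smul, denom_T]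
      simpa [ModularGroup.T, add_comm] using this
  | one => simp
  | mul x y _ _ hx hy =>
    intro r s τ
    rw [mul_smul, denom_mul_eq, ← mul_assoc, hx, hy]
    simp only [Matrix.SpecialLinearGroup.coe_mul, Matrix.mul_apply, Fin.sum_univ_two]
    push_cast
    congr 1 <;> ring
  | inv x _ hx =>
    intro r s τ
    have h1 := hx (r * x⁻¹ 0 0 + s * x⁻¹ 1 0) (r * x⁻¹ 0 1 + s * x⁻¹ 1 1) (x⁻¹ • τ)
    have h2 := denom_mul_eq x x⁻¹ τ
    have hdet : (x 0 0 * x 1 1 - x 0 1 * x 1 0 : ℂ) = 1 := by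
      have := x.det_coe
      rw [Matrix.det_fin_two] at this
      exact_mod_cast this
    rw [smul_inv_smul] at h1
    rw [mul_inv_cancel] at h2
    have h3 : (1 : ℂ) = UpperHalfPlane.denom x ↑(x⁻¹ • τ) * UpperHalfPlane.denom ↑x⁻¹ τ := by
      rw [← h2]
      simp
    have h4 : klein r s ↑(x⁻¹ • τ) = klein (r * x⁻¹ 0 0 + s * x⁻¹ 1 0)
        (r * x⁻¹ 0 1 + s * x⁻¹ 1 1) τ * UpperHalfPlane.denom x ↑(x⁻¹ • τ) := by
      rw [h1]
      simp only [Matrix.SpecialLinearGroup.SL2_inv_expl]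
      simp
      congr 1
      · linear_combination (-r) * hdet
      · linear_combination (-s) * hdet
    rw [h4, mul_assoc, ← h3, mul_one]

/-- The eighth power of the Dedekind eta function is modular of weight `4` up to cube roots of
unity. -/
lemma exists_eta_pow_eight_smul (M : Matrix.SpecialLinearGroup (Fin 2) ℤ) :
    ∃ ε : ℂ, ε ^ 3 = 1 ∧ ∀ τ : UpperHalfPlane,
      ModularForm.eta ↑(M • τ) ^ 8 =
        ε * UpperHalfPlane.denom M τ ^ 4 * ModularForm.eta τ ^ 8 := by
  have hM : M ∈ Subgroup.closure {ModularGroup.S, ModularGroup.T} := by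
    simp [SpecialLinearGroup.SL2Z_generators]
  induction hM using Subgroup.closure_induction with
  | mem x hx =>
    rcases hx with rfl | rfl
    · refine ⟨1, one_pow 3, fun τ ↦ ?_⟩
      have h : (τ : ℂ) ^ 4 = ((-I * τ) ^ (1 / 2 : ℂ)) ^ 8 := by
        rw [← Complex.cpow_nat_mul]
        norm_num [mul_pow, neg_pow, I_pow_four]
      rw [UpperHalfPlane.modular_S_smul, ModularGroup.denom_S, h]
      rw [UpperHalfPlane.coe_mk, inv_neg, ← one_div, ← neg_div, eta_neg_inv τ.im_pos]
      ring
    · refine ⟨cexp (2 * Real.pi * I / 3), ?_, fun τ ↦ ?_⟩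
      · rw [← Complex.exp_nat_mul, ← Complex.exp_two_pi_mul_I]
        congr 1
        push_cast
        ring
      · rw [UpperHalfPlane.modular_T_smul, denom_T, UpperHalfPlane.coe_vadd, add_comm,
          Complex.ofReal_one, eta_add_one, mul_pow, ← Complex.exp_nat_mul, one_pow, mul_one]
        congr 2
        push_cast
        ring
  | one => exact ⟨1, one_pow 3, by simp⟩
  | mul x y _ _ hx hy =>
    obtain ⟨ε, hε, hx⟩ := hx
    obtain ⟨δ, hδ, hy⟩ := hy
    refine ⟨ε * δ, by rw [mul_pow, hε, hδ, one_mul], fun τ ↦ ?_⟩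
    rw [mul_smul, hx, hy, denom_mul_eq]
    ring
  | inv x _ hx =>
    obtain ⟨ε, hε, hx⟩ := hx
    refine ⟨ε⁻¹, by rw [inv_pow, hε, inv_one], fun τ ↦ ?_⟩
    have h1 := hx (x⁻¹ • τ)
    have h2 := denom_mul_eq x x⁻¹ τ
    rw [smul_inv_smul] at h1
    have h3 : (1 : ℂ) = UpperHalfPlane.denom x ↑(x⁻¹ • τ) * UpperHalfPlane.denom ↑x⁻¹ τ := by
      rw [← h2]
      simp
    have h0 : ε ≠ 0 := by
      rintro rfl
      norm_num at hε
    rw [h1]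
    field_simp
    rw [mul_assoc, ← mul_pow, mul_comm (UpperHalfPlane.denom _ _), ← h3, one_pow, mul_one]

lemma etaF_eq_eta (z : ℂ) : etaF z = ModularForm.eta z := by
  simp_rw [etaF, ModularForm.eta, ModularForm.eta_q_eq_pow, Function.Periodic.qParam, qp]
  congr 2
  push_cast
  ring

lemma neg_one_zpow_eq_cexp (n : ℤ) : (-1 : ℂ) ^ n = cexp (Real.pi * I * n) := by
  rw [← Complex.exp_pi_mul_I, ← Complex.exp_int_mul, mul_comm]

lemma thetaSum_term_eq (k n : ℤ) (z : ℂ) :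
    (-1 : ℂ) ^ n * qp ((13 * (n : ℚ) ^ 2 + ((13 - 2 * k : ℤ) : ℚ) * (n : ℚ)) / 2) z =
      jacobiTheta₂_term n (-(k * z) + 13 * z / 2 + 1 / 2) (13 * z) := by
  rw [neg_one_zpow_eq_cexp, qp, jacobiTheta₂_term, ← Complex.exp_add]
  congr 1
  push_cast
  ring

lemma qp_mul_thetaSum_eq_klein (k : ℤ) {z : ℂ} (hz : 0 < z.im) :
    qp ((13 - 2 * k : ℤ) ^ 2 / 104) z * thetaSum (13 - 2 * k) z =
      klein (-k / 13) 0 (13 * z) * ModularForm.eta (13 * z) ^ 3 := by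
  have hz' : 0 < (13 * z).im := by simpa using hz
  have hη := ModularForm.eta_ne_zero hz'
  have h1 : (-k / 13 : ℂ) * (13 * z) + 0 + 13 * z / 2 + 1 / 2 =
    -(k * z) + 13 * z / 2 + 1 / 2 := by ring
  rw [klein, div_mul_cancel₀ _ (pow_ne_zero 3 hη), thetaSum, h1]
  simp_rw [thetaSum_term_eq]
  congr 1
  rw [qp]
  congr 1
  push_cast
  ring

lemma zpow_mul_zpow_eq_jacobiTheta₂_term (k n : ℤ) (z : ℂ) :
    (-cexp (2 * Real.pi * I * z) ^ (-k)) ^ n *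
        (cexp (2 * Real.pi * I * z) ^ 13) ^ (n * (n + 1) / 2) =
      jacobiTheta₂_term n (-(k * z) + 13 * z / 2 + 1 / 2) (13 * z) := by
  obtain ⟨m, hm⟩ := Int.even_mul_succ_self n
  have h : n * (n + 1) / 2 = m := by omega
  have hm' : (n : ℂ) * (n + 1) = m + m := by exact_mod_cast hm
  rw [h, neg_eq_neg_one_mul, mul_zpow, neg_one_zpow_eq_cexp, ← zpow_mul, ← zpow_natCast, ← zpow_mul,
    ← Complex.exp_int_mul, ← Complex.exp_int_mul, jacobiTheta₂_term, ← Complex.exp_add,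
    ← Complex.exp_add]
  congr 1
  push_cast
  linear_combination (-(13 * Real.pi * I * z)) * hm'

lemma thetaSum_eq_prod (k : ℤ) {z : ℂ} (hz : 0 < z.im) {q : ℂ}
    (hq : q = cexp (2 * Real.pi * I * z)) :
    thetaSum (13 - 2 * k) z = (∏' n : ℕ, (1 - (q ^ 13) ^ (n + 1))) *
      ((∏' n : ℕ, (1 - q ^ (13 - k) * (q ^ 13) ^ n)) *
        ∏' n : ℕ, (1 - q ^ k * (q ^ 13) ^ n)) := by
  have hq0 : q ≠ 0 := hq ▸ Complex.exp_ne_zero _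
  have hq1 : ‖q ^ 13‖ < 1 := by
    rw [norm_pow, hq]
    exact pow_lt_one₀ (norm_nonneg _) (UpperHalfPlane.norm_exp_two_pi_I_lt_one ⟨z, hz⟩) (by norm_num)
  have hz' : 0 < (13 * z).im := by simpa using hz
  have h := tsum_eq_jacobi_triple_product (pow_ne_zero 13 hq0) hq1 (zpow_ne_zero (-k) hq0)
  simp_rw [hq, zpow_mul_zpow_eq_jacobiTheta₂_term, ← thetaSum_term_eq] at h
  rw [thetaSum, h]
  · subst hq
    rw [← zpow_neg, neg_neg, sub_eq_neg_add, zpow_add₀ hq0]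
    norm_cast
  · simp_rw [thetaSum_term_eq]
    exact ((summable_jacobiTheta₂_term_iff _ _).2 hz').norm

lemma prod_range_mul_eq_prod_prod {M : Type*} [CommMonoid M] (f : ℕ → M) (m N : ℕ) :
    ∏ j ∈ range (m * N), f j = ∏ r ∈ range m, ∏ i ∈ range N, f (r + m * i) := by
  induction N with
  | zero => simp
  | succ N ih =>
    rw [Nat.mul_succ, prod_range_add, ih, ← prod_mul_distrib]
    exact prod_congr rfl fun r _ ↦ by rw [prod_range_succ, add_comm (m * N)]

lemma tprod_one_sub_pow_eq_prod_tprod {q : ℂ} (hq : ‖q‖ < 1) {m : ℕ} (hm : m ≠ 0) :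
    ∏' n : ℕ, (1 - q ^ (n + 1)) = ∏ r ∈ range m, ∏' n : ℕ, (1 - q ^ (r + 1) * (q ^ m) ^ n) := by
  have hqm : ‖q ^ m‖ < 1 := by
    rw [norm_pow]
    exact pow_lt_one₀ (norm_nonneg _) hq hm
  have h1 := (tendsto_prod_range_tprod_one_sub_mul_pow hq q).comp
    (Filter.tendsto_id.const_mul_atTop' (Nat.pos_of_ne_zero hm))
  have h2 := tendsto_finsetProd (range m) fun r _ ↦
    tendsto_prod_range_tprod_one_sub_mul_pow hqm (q ^ (r + 1))
  simp_rw [pow_succ' q] at h2 ⊢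
  refine tendsto_nhds_unique h1 (h2.congr fun N ↦ ?_)
  rw [Function.comp_apply, id, prod_range_mul_eq_prod_prod]
  refine prod_congr rfl fun r _ ↦ prod_congr rfl fun i _ ↦ ?_
  ring

lemma prod_thetaSum {z : ℂ} (hz : 0 < z.im) :
    ∏ k ∈ Icc (1 : ℤ) 6, thetaSum (13 - 2 * k) z =
      (∏' n : ℕ, (1 - (cexp (2 * Real.pi * I * z) ^ 13) ^ (n + 1))) ^ 5 *
        ∏' n : ℕ, (1 - cexp (2 * Real.pi * I * z) ^ (n + 1)) := by
  set q := cexp (2 * Real.pi * I * z) with hq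
  have hq1 : ‖q‖ < 1 := UpperHalfPlane.norm_exp_two_pi_I_lt_one ⟨z, hz⟩
  rw [tprod_one_sub_pow_eq_prod_tprod hq1 (m := 13) (by norm_num)]
  have hI : Icc (1 : ℤ) 6 = {1, 2, 3, 4, 5, 6} := rfl
  simp_rw [thetaSum_eq_prod _ hz hq, hI, prod_range_succ]
  simp
  norm_cast
  simp_rw [pow_succ' (q ^ 13)]
  ring

/-- The product of the Klein forms `klein (-k / 13) 0` for `1 ≤ k ≤ 6`. -/
def kleinProd (τ : ℂ) : ℂ := ∏ k ∈ Icc (1 : ℤ) 6, klein (-k / 13) 0 τ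

lemma eta_eq_kleinProd_mul {z : ℂ} (hz : 0 < z.im) :
    ModularForm.eta z = kleinProd (13 * z) * ModularForm.eta (13 * z) ^ 13 := by
  have hz' : 0 < (13 * z).im := by simpa using hz
  have h := prod_congr (rfl : Icc (1 : ℤ) 6 = Icc 1 6) fun k _ ↦ qp_mul_thetaSum_eq_klein k hz
  rw [prod_mul_distrib, prod_mul_distrib, prod_thetaSum hz, prod_const, ← kleinProd] at h
  have hI : Icc (1 : ℤ) 6 = {1, 2, 3, 4, 5, 6} := rfl
  have hqp : ∏ k ∈ Icc (1 : ℤ) 6, qp ((13 - 2 * k : ℤ) ^ 2 / 104) z =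
      qp (1 / 24) (13 * z) ^ 5 * qp (1 / 24) z := by
    simp_rw [qp, ← Complex.exp_sum, ← Complex.exp_nat_mul, ← Complex.exp_add, hI]
    congr 1
    simp
    ring
  have hexp : cexp (2 * Real.pi * I * (13 * z)) = cexp (2 * Real.pi * I * z) ^ 13 := by
    rw [← Complex.exp_nat_mul]
    congr 1
    push_cast
    ring
  have h5 : ModularForm.eta (13 * z) ^ 5 * ModularForm.eta z =
      kleinProd (13 * z) * (ModularForm.eta (13 * z) ^ 3) ^ 6 := by
    rw [hqp] at h
    simp only [Int.card_Icc, Int.reduceAdd, Int.reduceSub, Int.reduceToNat] at h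
    rw [← h, ← etaF_eq_eta, ← etaF_eq_eta, etaF, etaF, hexp]
    ring
  refine mul_left_cancel₀ (pow_ne_zero 5 (ModularForm.eta_ne_zero hz')) (h5.trans ?_)
  ring

lemma klein_smul_eq_self {M : Matrix.SpecialLinearGroup (Fin 2) ℤ} {a b : ℤ}
    (ha : M 0 0 = 1 + 13 * a) (hb : M 0 1 = 13 * (13 * b)) (k : ℤ) (τ : UpperHalfPlane) :
    klein (-k / 13) 0 ↑(M • τ) * UpperHalfPlane.denom M τ = klein (-k / 13) 0 τ := by
  have heven : Even (-k * a - k * a * (k * (13 * b)) + (-k * (13 * b)) + k * k * b) := by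
    have hdet := M.det_coe
    rw [Matrix.det_fin_two, ha, hb] at hdet
    have h : Odd ((1 + 13 * a) * M 1 1 - 13 * (13 * b) * M 1 0) := by
      rw [hdet]
      exact odd_one
    simp only [Int.even_add, Int.even_sub, Int.even_mul, even_neg, ← Int.not_even_iff_odd] at h ⊢
    have h13 : ¬ Even (13 : ℤ) := by decide
    have h1 : ¬ Even (1 : ℤ) := by decide
    tauto
  have h1 : (-k / 13 : ℂ) * M 0 0 + 0 * M 1 0 = -k / 13 + (-k * a : ℤ) := by
    rw [ha]
    push_cast
    ring
  have h2 : (-k / 13 : ℂ) * M 0 1 + 0 * M 1 1 = 0 + (-k * (13 * b) : ℤ) := by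
    rw [hb]
    push_cast
    ring
  rw [klein_smul, h1, h2, klein_add_intCast_left, klein_add_intCast_right, ← mul_assoc,
    ← Complex.exp_add]
  obtain ⟨m, hm⟩ := heven
  have hm' : (-k * a - k * a * (k * (13 * b)) + (-k * (13 * b)) + k * k * b : ℂ) = m + m := by
    exact_mod_cast hm
  convert one_mul _
  rw [Complex.exp_eq_one_iff]
  refine ⟨m, ?_⟩
  push_cast
  linear_combination (Real.pi * I) * hm'


lemma exists_X_eq (i : Fin 6) : ∃ (s : ℂ) (k : ℤ), ∀ z : ℂ, 0 < z.im →
    X z i = s * (kleinProd (13 * z) * klein (-k / 13) 0 (13 * z) *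
      ModularForm.eta (13 * z) ^ 16) := by
  have key (s : ℂ) (k : ℤ)
      (h : ∀ z, thc (i + 1) z = s * (qp ((13 - 2 * k : ℤ) ^ 2 / 104) z * thetaSum (13 - 2 * k) z))
      (z : ℂ) (hz : 0 < z.im) :
      X z i = s * (kleinProd (13 * z) * klein (-k / 13) 0 (13 * z) *
        ModularForm.eta (13 * z) ^ 16) := by
    rw [X, h, qp_mul_thetaSum_eq_klein k hz, etaF_eq_eta, eta_eq_kleinProd_mul hz]
    ring
  fin_cases i
  · exact ⟨1, 1, key 1 1 fun z ↦ by norm_num [thc]⟩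
  · exact ⟨1, 3, key 1 3 fun z ↦ by norm_num [thc]⟩
  · exact ⟨1, 4, key 1 4 fun z ↦ by norm_num [thc]⟩
  · exact ⟨-1, 5, key (-1) 5 fun z ↦ by norm_num [thc]⟩
  · exact ⟨1, 2, key 1 2 fun z ↦ by norm_num [thc]⟩
  · exact ⟨1, 6, key 1 6 fun z ↦ by norm_num [thc]⟩

/-- for `γ ∈ SL(2,ℤ)` with `γ ≡ 1 (mod 13)`, there is a cube root of unity `u`
with `x_i(γz) = u·(cz+d)·x_i(z)` for all `z ∈ ℍ` and all `i`. -/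
theorem stmt_8 (γ : Matrix.SpecialLinearGroup (Fin 2) ℤ)
    (ha : ((γ.1 0 0 : ℤ) : ZMod 13) = 1) (hb : ((γ.1 0 1 : ℤ) : ZMod 13) = 0)
    (hc : ((γ.1 1 0 : ℤ) : ZMod 13) = 0) (hd : ((γ.1 1 1 : ℤ) : ZMod 13) = 1) :
    ∃ u : ℂ, u ^ 3 = 1 ∧ ∀ z : ℂ, 0 < z.im → ∀ i : Fin 6,
      X (((γ.1 0 0 : ℂ) * z + (γ.1 0 1 : ℂ)) / ((γ.1 1 0 : ℂ) * z + (γ.1 1 1 : ℂ))) i =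
        u * ((γ.1 1 0 : ℂ) * z + (γ.1 1 1 : ℂ)) * X z i := by
  have ha' : ((γ.1 0 0 - 1 : ℤ) : ZMod 13) = 0 := by rw [Int.cast_sub, ha]; simp
  obtain ⟨a, ha⟩ := (ZMod.intCast_zmod_eq_zero_iff_dvd _ 13).1 ha'
  obtain ⟨b, hb⟩ := (ZMod.intCast_zmod_eq_zero_iff_dvd _ 13).1 hb
  obtain ⟨c, hc⟩ := (ZMod.intCast_zmod_eq_zero_iff_dvd _ 13).1 hc
  push_cast at ha hb hc
  have hdet := γ.det_coe
  rw [Matrix.det_fin_two] at hdet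
  let M : Matrix.SpecialLinearGroup (Fin 2) ℤ :=
    ⟨!![γ.1 0 0, 13 * γ.1 0 1; c, γ.1 1 1], by
      rw [Matrix.det_fin_two_of]
      linear_combination hdet + γ.1 0 1 * hc⟩
  obtain ⟨ε, hε, hη⟩ := exists_eta_pow_eight_smul M
  refine ⟨ε ^ 2, by rw [← pow_mul, mul_comm, pow_mul, hε, one_pow], fun z hz i ↦ ?_⟩
  obtain ⟨s, k, hX⟩ := exists_X_eq i
  let τ : UpperHalfPlane := ⟨13 * z, by simpa using hz⟩
  have hj : UpperHalfPlane.denom M τ = (γ.1 1 0 : ℂ) * z + γ.1 1 1 := by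
    rw [ModularGroup.denom_apply, hc]
    simp [M, τ]
    ring
  have hγ : ((M • τ : UpperHalfPlane) : ℂ) =
      13 * (((γ.1 0 0 : ℂ) * z + γ.1 0 1) / ((γ.1 1 0 : ℂ) * z + γ.1 1 1)) := by
    rw [UpperHalfPlane.coe_specialLinearGroup_apply, ← hj, ModularGroup.denom_apply]
    simp [M, τ]
    ring
  have hk := klein_smul_eq_self (M := M) (a := a) (b := b) (by simp [M]; linarith)
    (by simp [M]; linarith)
  have him : 0 < (((γ.1 0 0 : ℂ) * z + γ.1 0 1) / ((γ.1 1 0 : ℂ) * z + γ.1 1 1)).im := by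
    have := (M • τ).im_pos
    rw [← UpperHalfPlane.coe_im, hγ] at this
    simpa using this
  have hG : kleinProd ↑(M • τ) * UpperHalfPlane.denom M τ ^ 6 = kleinProd τ := by
    have := prod_congr (rfl : Icc (1 : ℤ) 6 = Icc 1 6) fun k _ ↦ hk k τ
    rwa [prod_mul_distrib, prod_const] at this
  rw [hX _ him, hX z hz, ← hγ, ← hj]
  have hτ : 13 * z = τ := rfl
  rw [hτ, ← hG, ← hk k τ]
  rw [show 16 = 8 * 2 from rfl, pow_mul, pow_mul, hη τ]
  ring

end
end
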